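/- Let Δq = ∫₀¹ q_def(y) dy − (1/a)·∫₀ᵃ q_per(y) dy. If (a·Δq)/(2π²) ∉ 𝓕(a), then all but finitely many gaps contain exactly one defect eigenvalue; that is, the collection of bounded connected components G of {E : ℝ | k(E)² > 4} for which the set {E ∈ G | E is a defect eigenvalue} does not have exactly one element is finite. -/

import Mathlib

open Matrix MeasureTheory

/-- A set `S ⊆ ℝ` is locally finite if every point has a neighborhood meeting `S` in a
finite set. -/
def LocallyFiniteSet (S : Set ℝ) : Prop :=
  ∀ x : ℝ, ∃ U ∈ nhds x, (S ∩ U).Finite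

/-- A function is piecewise continuous if it is continuous off a locally finite set. -/
def PiecewiseContinuous (f : ℝ → ℝ) : Prop :=
  ∃ S : Set ℝ, LocallyFiniteSet S ∧ ContinuousOn f Sᶜ

/-- `W` is the fundamental solution matrix of `-u'' + p u = E u`, i.e. the continuous
solution of `W x = 1 + ∫₀ˣ !![0, 1; p s - E, 0] * W s ds` (read entrywise). -/
def IsFundamentalSolution (p : ℝ → ℝ) (E : ℝ)
    (W : ℝ → Matrix (Fin 2) (Fin 2) ℝ) : Prop :=
  (∀ i j, Continuous fun x => W x i j) ∧
    ∀ (x : ℝ) (i j : Fin 2), W x i j =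
      (1 : Matrix (Fin 2) (Fin 2) ℝ) i j +
        ∫ s in (0:ℝ)..x, (!![0, 1; p s - E, 0] * W s) i j

/-- `E` is a defect eigenvalue for the potential `q`: there is a differentiable,
not identically zero, square-integrable function `u` with
`u' x = u' 0 + ∫₀ˣ (q s - E) u s ds` for all `x` (i.e. `-u'' + q u = E u`). -/
def IsDefectEigenvalue (q : ℝ → ℝ) (E : ℝ) : Prop :=
  ∃ u : ℝ → ℝ, Differentiable ℝ u ∧ u ≠ 0 ∧
    Integrable (fun x => (u x) ^ 2) ∧
    ∀ x : ℝ, deriv u x = deriv u 0 + ∫ s in (0:ℝ)..x, (q s - E) * u s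

/-- `G` is a gap of the Floquet discriminant `k`: a bounded connected component of
`{E | k E ^ 2 > 4}`. -/
def IsGap (k : ℝ → ℝ) (G : Set ℝ) : Prop :=
  Bornology.IsBounded G ∧
    ∃ E ∈ {E : ℝ | k E ^ 2 > 4}, G = connectedComponentIn {E : ℝ | k E ^ 2 > 4} E

/-- For `a : ℝ`, `Fset a` is the set of `y : ℝ` such that for every `δ > 0` there are
infinitely many pairs of integers `(N, M)` with `M ≥ 1` and `|y - M * (N - M * a)| < δ`. -/
def Fset (a : ℝ) : Set ℝ :=
  {y | ∀ δ > 0,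
    {p : ℤ × ℤ | 1 ≤ p.2 ∧ |y - (p.2 : ℝ) * ((p.1 : ℝ) - (p.2 : ℝ) * a)| < δ}.Infinite}

open Set Filter Topology

/-! ### Admissible potentials -/

/-- Bounded functions that are continuous off a closed countable set. -/
def IsPotential (p : ℝ → ℝ) : Prop :=
  (∃ C, ∀ x, |p x| ≤ C) ∧
    ∃ S : Set ℝ, IsClosed S ∧ S.Countable ∧ ∀ x ∉ S, ContinuousAt p x

theorem LocallyFiniteSet.isClosed {S : Set ℝ} (hS : LocallyFiniteSet S) : IsClosed S := by
  rw [← isOpen_compl_iff, isOpen_iff_mem_nhds]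
  intro x hx
  obtain ⟨V, hV, hfin⟩ := hS x
  have h1 : (S ∩ V)ᶜ ∈ 𝓝 x := hfin.isClosed.isOpen_compl.mem_nhds fun h => hx h.1
  filter_upwards [hV, h1] with y hy hy' hyS
  exact hy' ⟨hyS, hy⟩

theorem LocallyFiniteSet.countable {S : Set ℝ} (hS : LocallyFiniteSet S) : S.Countable := by
  choose V hV hfin using hS
  obtain ⟨t, ht, hcov⟩ := TopologicalSpace.countable_cover_nhds hV
  have : S ⊆ ⋃ x ∈ t, S ∩ V x := by
    intro y hy
    have : y ∈ ⋃ x ∈ t, V x := hcov ▸ mem_univ y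
    simp only [mem_iUnion] at this ⊢
    obtain ⟨x, hx, hyx⟩ := this
    exact ⟨x, hx, hy, hyx⟩
  exact (ht.biUnion fun x _ => (hfin x).countable).mono this

theorem PiecewiseContinuous.isPotential {p : ℝ → ℝ} (hp : PiecewiseContinuous p)
    (hb : ∃ C, ∀ x, |p x| ≤ C) : IsPotential p := by
  obtain ⟨S, hS, hc⟩ := hp
  exact ⟨hb, S, hS.isClosed, hS.countable, fun x hx =>
    hc.continuousAt (hS.isClosed.isOpen_compl.mem_nhds hx)⟩

theorem IsPotential.sub_const {p : ℝ → ℝ} (hp : IsPotential p) (E : ℝ) :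
    IsPotential fun x => p x - E := by
  obtain ⟨⟨C, hC⟩, S, h1, h2, h3⟩ := hp
  refine ⟨⟨C + |E|, fun x => (abs_sub _ _).trans ?_⟩, S, h1, h2, fun x hx =>
    (h3 x hx).sub continuousAt_const⟩
  linarith [hC x]

theorem isPotential_const (c : ℝ) : IsPotential fun _ => c :=
  ⟨⟨|c|, fun _ => le_rfl⟩, ∅, isClosed_empty, countable_empty, fun _ _ => continuousAt_const⟩

theorem IsPotential.comp_sub {p : ℝ → ℝ} (hp : IsPotential p) (b : ℝ) :
    IsPotential fun x => p (x - b) := by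
  obtain ⟨⟨C, hC⟩, S, h1, h2, h3⟩ := hp
  have hinj : Function.Injective fun x : ℝ => x - b := sub_left_injective
  refine ⟨⟨C, fun x => hC _⟩, (fun x => x - b) ⁻¹' S, h1.preimage (by fun_prop),
    h2.preimage hinj, fun x hx => ?_⟩
  exact ContinuousAt.comp (f := fun x : ℝ => x - b) (h3 _ hx) (by fun_prop)

theorem IsPotential.ite_le {p r : ℝ → ℝ} (hp : IsPotential p) (hr : IsPotential r) (b : ℝ) :
    IsPotential fun x => if x ≤ b then p x else r x := by
  obtain ⟨⟨C, hC⟩, S, h1, h2, h3⟩ := hp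
  obtain ⟨⟨C', hC'⟩, S', h1', h2', h3'⟩ := hr
  refine ⟨⟨max C C', fun x => ?_⟩, S ∪ S' ∪ {b}, (h1.union h1').union isClosed_singleton,
    (h2.union h2').union (countable_singleton b), fun x hx => ?_⟩
  · dsimp only
    split_ifs
    · exact le_max_of_le_left (hC x)
    · exact le_max_of_le_right (hC' x)
  · simp only [mem_union, mem_singleton_iff, not_or] at hx
    rcases lt_or_gt_of_ne hx.2 with h | h
    · refine (h3 x hx.1.1).congr ?_
      filter_upwards [eventually_lt_nhds h] with y hy
      rw [if_pos hy.le]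
    · refine (h3' x hx.1.2).congr ?_
      filter_upwards [eventually_gt_nhds h] with y hy
      rw [if_neg (not_le.2 hy)]

theorem IsPotential.ite_lt {p r : ℝ → ℝ} (hp : IsPotential p) (hr : IsPotential r) (b : ℝ) :
    IsPotential fun x => if x < b then p x else r x := by
  obtain ⟨⟨C, hC⟩, S, h1, h2, h3⟩ := hp
  obtain ⟨⟨C', hC'⟩, S', h1', h2', h3'⟩ := hr
  refine ⟨⟨max C C', fun x => ?_⟩, S ∪ S' ∪ {b}, (h1.union h1').union isClosed_singleton,
    (h2.union h2').union (countable_singleton b), fun x hx => ?_⟩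
  · dsimp only
    split_ifs
    · exact le_max_of_le_left (hC x)
    · exact le_max_of_le_right (hC' x)
  · simp only [mem_union, mem_singleton_iff, not_or] at hx
    rcases lt_or_gt_of_ne hx.2 with h | h
    · refine (h3 x hx.1.1).congr ?_
      filter_upwards [eventually_lt_nhds h] with y hy
      rw [if_pos hy]
    · refine (h3' x hx.1.2).congr ?_
      filter_upwards [eventually_gt_nhds h] with y hy
      rw [if_neg (not_lt.2 hy.le)]

theorem IsPotential.aestronglyMeasurable {p : ℝ → ℝ} (hp : IsPotential p) :
    AEStronglyMeasurable p volume := by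
  obtain ⟨-, S, h1, h2, h3⟩ := hp
  have hc : ContinuousOn p Sᶜ := fun x hx => (h3 x hx).continuousWithinAt
  have h := hc.aestronglyMeasurable (μ := volume) h1.isOpen_compl.measurableSet
  rwa [Measure.restrict_eq_self_of_ae_mem] at h
  rw [ae_iff]
  simpa using h2.measure_zero volume

theorem IsPotential.intervalIntegrable {p : ℝ → ℝ} (hp : IsPotential p) (x y : ℝ) :
    IntervalIntegrable p volume x y := by
  obtain ⟨C, hC⟩ := hp.1
  rw [intervalIntegrable_iff]
  exact Measure.integrableOn_of_bounded (M := C) (by simp) hp.aestronglyMeasurable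
    (Eventually.of_forall hC)

theorem IsPotential.intervalIntegrable_mul {p f : ℝ → ℝ} (hp : IsPotential p)
    (hf : Continuous f) (x y : ℝ) :
    IntervalIntegrable (fun s => p s * f s) volume x y :=
  (hp.intervalIntegrable x y).mul_continuousOn hf.continuousOn

theorem IsPotential.hasDerivAt_integral_mul {p f : ℝ → ℝ} (hp : IsPotential p)
    (hf : Continuous f) {x : ℝ} (hx : ContinuousAt p x) :
    HasDerivAt (fun y => ∫ s in (0:ℝ)..y, p s * f s) (p x * f x) x := by
  refine intervalIntegral.integral_hasDerivAt_right (hp.intervalIntegrable_mul hf _ _) ?_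
    (hx.mul hf.continuousAt)
  exact (hp.aestronglyMeasurable.mul
    hf.aestronglyMeasurable).stronglyMeasurableAtFilter

/-! ### Solutions of `u'' = p u` -/

/-- `(u, v)` is continuous and satisfies `u' = v`, `v' = p u` on `I` off a countable set. -/
def SolvesOn (p u v : ℝ → ℝ) (I : Set ℝ) : Prop :=
  Continuous u ∧ Continuous v ∧ ∃ S : Set ℝ, S.Countable ∧
    ∀ x ∈ I \ S, HasDerivAt u (v x) x ∧ HasDerivAt v (p x * u x) x

theorem SolvesOn.mono {p u v : ℝ → ℝ} {I I' : Set ℝ} (h : SolvesOn p u v I) (hI : I' ⊆ I) :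
    SolvesOn p u v I' := by
  obtain ⟨hu, hv, S, hS, hd⟩ := h
  exact ⟨hu, hv, S, hS, fun x hx => hd x ⟨hI hx.1, hx.2⟩⟩

theorem SolvesOn.congr {p p' u v : ℝ → ℝ} {I : Set ℝ} (h : SolvesOn p u v I)
    (hp : ∀ x ∈ I, p x = p' x) : SolvesOn p' u v I := by
  obtain ⟨hu, hv, S, hS, hd⟩ := h
  exact ⟨hu, hv, S, hS, fun x hx => hp x hx.1 ▸ hd x hx⟩

theorem SolvesOn.comp_add {p u v : ℝ → ℝ} {I : Set ℝ} (h : SolvesOn p u v I) (b : ℝ) :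
    SolvesOn (fun x => p (x + b)) (fun x => u (x + b)) (fun x => v (x + b))
      ((fun x => x + b) ⁻¹' I) := by
  obtain ⟨hu, hv, S, hS, hd⟩ := h
  refine ⟨hu.comp (by fun_prop), hv.comp (by fun_prop), (fun x => x + b) ⁻¹' S,
    hS.preimage (add_left_injective b), fun x hx => ?_⟩
  obtain ⟨h1, h2⟩ := hd (x + b) hx
  exact ⟨h1.comp_add_const x b, h2.comp_add_const x b⟩

theorem solvesOn_of_integral {p u v : ℝ → ℝ} (hp : IsPotential p) (hu : Continuous u)
    (hv : Continuous v) (hu' : ∀ x, u x = u 0 + ∫ s in (0:ℝ)..x, v s)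
    (hv' : ∀ x, v x = v 0 + ∫ s in (0:ℝ)..x, p s * u s) : SolvesOn p u v univ := by
  obtain ⟨S, -, hS, hc⟩ := hp.2
  refine ⟨hu, hv, S, hS, fun x hx => ⟨?_, ?_⟩⟩
  · rw [funext hu']
    exact (hv.integral_hasStrictDerivAt 0 x).hasDerivAt.const_add _
  · rw [funext hv']
    simpa only [← hv'] using (hp.hasDerivAt_integral_mul hu (hc x hx.2)).const_add (v 0)

theorem SolvesOn.integral_fst {p u v : ℝ → ℝ} {x y : ℝ}
    (h : SolvesOn p u v (Ioo (min x y) (max x y))) : ∫ s in x..y, v s = u y - u x := by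
  obtain ⟨hu, hv, S, hS, hd⟩ := h
  exact integral_eq_of_hasDerivAt_off_countable _ _ hS hu.continuousOn
    (fun z hz => (hd z hz).1) (hv.intervalIntegrable _ _)

theorem SolvesOn.integral_snd {p u v : ℝ → ℝ} {x y : ℝ} (hp : IsPotential p)
    (h : SolvesOn p u v (Ioo (min x y) (max x y))) :
    ∫ s in x..y, p s * u s = v y - v x := by
  obtain ⟨hu, hv, S, hS, hd⟩ := h
  exact integral_eq_of_hasDerivAt_off_countable _ _ hS hv.continuousOn
    (fun z hz => (hd z hz).2) (hp.intervalIntegrable_mul hu _ _)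

/-- The Wronskian identity for solutions of two different equations. -/
theorem SolvesOn.integral_wronskian {p p' u v u' v' : ℝ → ℝ} {x y : ℝ}
    (hp : IsPotential p) (hp' : IsPotential p')
    (h : SolvesOn p u v (Ioo (min x y) (max x y)))
    (h' : SolvesOn p' u' v' (Ioo (min x y) (max x y))) :
    ∫ s in x..y, (p' s - p s) * (u s * u' s) =
      (u y * v' y - v y * u' y) - (u x * v' x - v x * u' x) := by
  obtain ⟨hu, hv, S, hS, hd⟩ := h
  obtain ⟨hu', hv', S', hS', hd'⟩ := h'
  have hcont : Continuous fun s => u s * u' s := hu.mul hu'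
  refine integral_eq_of_hasDerivAt_off_countable (fun s => u s * v' s - v s * u' s) _
    (hS.union hS') (by fun_prop) (fun z hz => ?_) ?_
  · obtain ⟨h1, h2⟩ := hd z ⟨hz.1, fun h => hz.2 (Or.inl h)⟩
    obtain ⟨h1', h2'⟩ := hd' z ⟨hz.1, fun h => hz.2 (Or.inr h)⟩
    exact ((h1.mul h2').sub (h2.mul h1')).congr_deriv (by ring)
  · simp only [sub_mul]
    exact (hp'.intervalIntegrable_mul hcont _ _).sub (hp.intervalIntegrable_mul hcont _ _)

/-! ### Fundamental solutions -/

section Fundamental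

variable {p : ℝ → ℝ} {E : ℝ} {W : ℝ → Matrix (Fin 2) (Fin 2) ℝ}

theorem IsFundamentalSolution.zero (hW : IsFundamentalSolution p E W) : W 0 = 1 := by
  ext i j
  simpa using hW.2 0 i j

theorem IsFundamentalSolution.solvesOn (hp : IsPotential p) (hW : IsFundamentalSolution p E W)
    (j : Fin 2) : SolvesOn (fun x => p x - E) (fun x => W x 0 j) (fun x => W x 1 j) univ := by
  refine solvesOn_of_integral (hp.sub_const E) (hW.1 0 j) (hW.1 1 j) (fun x => ?_) fun x => ?_
  · have := hW.2 x 0 j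
    simpa [Matrix.mul_apply, Fin.sum_univ_two, hW.zero] using this
  · have := hW.2 x 1 j
    simpa [Matrix.mul_apply, Fin.sum_univ_two, hW.zero] using this

theorem IsFundamentalSolution.hasDerivAt_fst (hW : IsFundamentalSolution p E W) (j : Fin 2)
    (x : ℝ) : HasDerivAt (fun x => W x 0 j) (W x 1 j) x := by
  have h : (fun x => W x 0 j) = fun x => (1 : Matrix (Fin 2) (Fin 2) ℝ) 0 j +
      ∫ s in (0:ℝ)..x, W s 1 j := by
    ext x
    have := hW.2 x 0 j
    simpa [Matrix.mul_apply, Fin.sum_univ_two] using this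
  rw [h]
  exact ((hW.1 1 j).integral_hasStrictDerivAt 0 x).hasDerivAt.const_add _

theorem IsFundamentalSolution.det_eq (hp : IsPotential p) (hW : IsFundamentalSolution p E W)
    (x : ℝ) : W x 0 0 * W x 1 1 - W x 1 0 * W x 0 1 = 1 := by
  have h := SolvesOn.integral_wronskian (x := 0) (y := x) (hp.sub_const E) (hp.sub_const E)
    ((hW.solvesOn hp 0).mono (subset_univ _)) ((hW.solvesOn hp 1).mono (subset_univ _))
  simp [hW.zero] at h
  linarith

/-- Variation of constants. -/
theorem IsFundamentalSolution.variation {r u v : ℝ → ℝ} {x : ℝ}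
    (hp : IsPotential p) (hW : IsFundamentalSolution p E W) (hr : IsPotential r)
    (h : SolvesOn r u v (Ioo (min 0 x) (max 0 x))) :
    u x = W x 0 0 * (u 0 - ∫ s in (0:ℝ)..x, (r s - (p s - E)) * (W s 0 1 * u s)) +
        W x 0 1 * (v 0 + ∫ s in (0:ℝ)..x, (r s - (p s - E)) * (W s 0 0 * u s)) ∧
    v x = W x 1 0 * (u 0 - ∫ s in (0:ℝ)..x, (r s - (p s - E)) * (W s 0 1 * u s)) +
        W x 1 1 * (v 0 + ∫ s in (0:ℝ)..x, (r s - (p s - E)) * (W s 0 0 * u s)) := by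
  have h0 := SolvesOn.integral_wronskian (hp.sub_const E) hr
    ((hW.solvesOn hp 0).mono (subset_univ _)) h
  have h1 := SolvesOn.integral_wronskian (hp.sub_const E) hr
    ((hW.solvesOn hp 1).mono (subset_univ _)) h
  have hd := hW.det_eq hp x
  rw [h0, h1]
  simp only [hW.zero, Matrix.one_apply_eq, ne_eq, zero_ne_one, one_ne_zero, not_false_eq_true,
    Matrix.one_apply_ne]
  constructor
  · linear_combination -(u x) * hd
  · linear_combination -(v x) * hd

theorem IsFundamentalSolution.eq_of_solvesOn {u v : ℝ → ℝ} {x : ℝ}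
    (hp : IsPotential p) (hW : IsFundamentalSolution p E W)
    (h : SolvesOn (fun s => p s - E) u v (Ioo (min 0 x) (max 0 x))) :
    u x = W x 0 0 * u 0 + W x 0 1 * v 0 ∧ v x = W x 1 0 * u 0 + W x 1 1 * v 0 := by
  simpa using hW.variation hp (hp.sub_const E) h

theorem IsFundamentalSolution.add_period {a : ℝ} (hp : IsPotential p)
    (hW : IsFundamentalSolution p E W) (hper : ∀ x, p (x + a) = p x) (x : ℝ) :
    W (x + a) = W x * W a := by
  have key : ∀ j, W (x + a) 0 j = (W x * W a) 0 j ∧ W (x + a) 1 j = (W x * W a) 1 j := by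
    intro j
    have h := ((hW.solvesOn hp j).comp_add a).congr (p' := fun s => p s - E) fun s _ => by
      simp [hper]
    have := hW.eq_of_solvesOn hp (h.mono (subset_univ _)) (x := x)
    simpa [Matrix.mul_apply, Fin.sum_univ_two] using this
  ext i j
  fin_cases i
  · exact (key j).1
  · exact (key j).2

end Fundamental

/-! ### Dependence on the spectral parameter -/

/-- The quadratic form `z ↦ z ∧ X z` of a `2 × 2` matrix. -/
def wedgeForm (X : Matrix (Fin 2) (Fin 2) ℝ) (x y : ℝ) : ℝ :=
  X 1 0 * x ^ 2 + (X 1 1 - X 0 0) * (x * y) - X 0 1 * y ^ 2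

/-- Positive definiteness of `wedgeForm`. -/
def WedgePos (X : Matrix (Fin 2) (Fin 2) ℝ) : Prop :=
  ∀ x y : ℝ, (x ≠ 0 ∨ y ≠ 0) → 0 < wedgeForm X x y

/-- A differentiable family in `SL(2, ℝ)` whose logarithmic derivative rotates every vector
clockwise. -/
def IsClockwise (M : ℝ → Matrix (Fin 2) (Fin 2) ℝ) : Prop :=
  ∀ E, (M E).det = 1 ∧ ∃ A : Matrix (Fin 2) (Fin 2) ℝ, A.trace = 0 ∧ WedgePos (-A) ∧
    ∀ i j, HasDerivAt (fun E => M E i j) ((M E * A) i j) E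

theorem hasDerivAt_of_eq_add_mul {f g : ℝ → ℝ} {x : ℝ}
    (h : ∀ᶠ y in 𝓝 x, f y = f x + (y - x) * g y) (hg : ContinuousAt g x) :
    HasDerivAt f (g x) x := by
  rw [hasDerivAt_iff_tendsto_slope]
  refine (hg.tendsto.mono_left nhdsWithin_le_nhds).congr' ?_
  filter_upwards [nhdsWithin_le_nhds h, self_mem_nhdsWithin] with y hy hne
  have : y - x ≠ 0 := sub_ne_zero.2 hne
  rw [slope_def_field, hy]
  field_simp
  ring

theorem abs_integral_le_of_bound {f : ℝ → ℝ} {B L x : ℝ} (hx0 : 0 ≤ x) (hxL : x ≤ L)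
    (hB : 0 ≤ B) (hf : ∀ s ∈ Icc 0 L, |f s| ≤ B) : |∫ s in (0:ℝ)..x, f s| ≤ B * L := by
  have h := intervalIntegral.norm_integral_le_of_norm_le_const (a := 0) (b := x) (f := f) (C := B)
    fun s hs => by
      rw [uIoc_of_le hx0] at hs
      exact hf s ⟨hs.1.le, hs.2.trans hxL⟩
  rw [Real.norm_eq_abs, sub_zero, abs_of_nonneg hx0] at h
  exact h.trans (mul_le_mul_of_nonneg_left hxL hB)

section Spectral

variable {p : ℝ → ℝ} {W : ℝ → ℝ → Matrix (Fin 2) (Fin 2) ℝ}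

theorem IsFundamentalSolution.exists_bound {p : ℝ → ℝ} {E : ℝ} {W : ℝ → Matrix (Fin 2) (Fin 2) ℝ}
    (hW : IsFundamentalSolution p E W) (L : ℝ) :
    ∃ C, 0 < C ∧ ∀ j, ∀ x ∈ Icc 0 L, |W x 0 j| ≤ C := by
  have h : ∀ j, ∃ C, ∀ x ∈ Icc 0 L, |W x 0 j| ≤ C := fun j =>
    isCompact_Icc.exists_bound_of_continuousOn (hW.1 0 j).continuousOn
  choose C hC using h
  refine ⟨max 1 (max (C 0) (C 1)), by positivity, fun j x hx => ?_⟩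
  fin_cases j
  · exact (hC 0 x hx).trans (by simp)
  · exact (hC 1 x hx).trans (by simp)

theorem variation_energy (hp : IsPotential p) (hW : ∀ E, IsFundamentalSolution p E (W E))
    (E₀ E x : ℝ) (j : Fin 2) :
    (∀ i, W E x i j = W E₀ x i j + (E - E₀) *
      (W E₀ x i 0 * (∫ s in (0:ℝ)..x, W E₀ s 0 1 * W E s 0 j) -
        W E₀ x i 1 * ∫ s in (0:ℝ)..x, W E₀ s 0 0 * W E s 0 j)) := by
  have h := (hW E₀).variation hp (hp.sub_const E)
    (((hW E).solvesOn hp j).mono (subset_univ _)) (x := x)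
  have e : ∀ s, p s - E - (p s - E₀) = -(E - E₀) := fun s => by ring
  simp only [e, intervalIntegral.integral_const_mul, (hW E).zero] at h
  intro i
  have two : ∀ l : Fin 2, l = 0 ∨ l = 1 := by decide
  rcases two j with rfl | rfl <;> rcases two i with rfl | rfl <;> simp at h ⊢ <;>
    linarith [h.1, h.2]

/-- Solutions depend Lipschitz continuously on the energy, uniformly on compact intervals. -/
theorem exists_energy_bound (hp : IsPotential p) (hW : ∀ E, IsFundamentalSolution p E (W E))
    (E₀ : ℝ) {L : ℝ} (hL : 0 < L) : ∃ C, 0 < C ∧ ∃ ε > 0, ∀ E, |E - E₀| < ε → ∀ j,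
      ∀ x ∈ Icc 0 L, |W E₀ x 0 j| ≤ C ∧ |W E x 0 j - W E₀ x 0 j| ≤ C * |E - E₀| := by
  obtain ⟨C, hC, hCb⟩ := (hW E₀).exists_bound L
  have hε : 0 < 1 / (4 * C * C * L) := by positivity
  refine ⟨max C (2 * C * (C * (2 * C) * L)), by positivity, _, hε, fun E hE j => ?_⟩
  obtain ⟨z, hz, hmax⟩ := isCompact_Icc.exists_isMaxOn (nonempty_Icc.2 hL.le)
    ((hW E).1 0 j).abs.continuousOn
  set K := |W E z 0 j| with hK
  have hKx : ∀ x ∈ Icc 0 L, |W E x 0 j| ≤ K := fun x hx => hmax hx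
  have hK0 : 0 ≤ K := abs_nonneg _
  have step : ∀ x ∈ Icc 0 L, |W E x 0 j - W E₀ x 0 j| ≤ |E - E₀| * (2 * C * (C * K * L)) := by
    intro x hx
    rw [variation_energy hp hW E₀ E x j 0, add_sub_cancel_left, abs_mul]
    refine mul_le_mul_of_nonneg_left ?_ (abs_nonneg _)
    have hint : ∀ i, |∫ s in (0:ℝ)..x, W E₀ s 0 i * W E s 0 j| ≤ C * K * L := fun i =>
      abs_integral_le_of_bound hx.1 hx.2 (by positivity) fun s hs => by
        rw [abs_mul]
        exact mul_le_mul (hCb i s hs) (hKx s hs) (abs_nonneg _) hC.le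
    have hprod : ∀ i i', |W E₀ x 0 i * ∫ s in (0:ℝ)..x, W E₀ s 0 i' * W E s 0 j| ≤
        C * (C * K * L) := fun i i' => by
      rw [abs_mul]
      exact mul_le_mul (hCb i x hx) (hint i') (abs_nonneg _) hC.le
    refine (abs_sub _ _).trans ?_
    linarith [hprod 0 1, hprod 1 0]
  have hK2 : K ≤ 2 * C := by
    have h1 := step z hz
    have h2 : |E - E₀| * (2 * C * (C * K * L)) ≤ 1 / (4 * C * C * L) * (2 * C * (C * K * L)) :=
      mul_le_mul_of_nonneg_right hE.le (by positivity)
    have h3 : 1 / (4 * C * C * L) * (2 * C * (C * K * L)) = K / 2 := by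
      field_simp
      ring
    have h4 := abs_sub_abs_le_abs_sub (W E z 0 j) (W E₀ z 0 j)
    have h5 := hCb j z hz
    linarith
  intro x hx
  refine ⟨(hCb j x hx).trans (le_max_left _ _), (step x hx).trans ?_⟩
  rw [mul_comm]
  refine mul_le_mul_of_nonneg_right (le_trans ?_ (le_max_right _ _)) (abs_nonneg _)
  gcongr

theorem continuousAt_integral_energy (hp : IsPotential p)
    (hW : ∀ E, IsFundamentalSolution p E (W E)) (E₀ : ℝ) {L : ℝ} (hL : 0 < L) (i j : Fin 2) :
    ContinuousAt (fun E => ∫ s in (0:ℝ)..L, W E₀ s 0 i * W E s 0 j) E₀ := by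
  obtain ⟨C, hC, ε, hε, hb⟩ := exists_energy_bound hp hW E₀ hL
  have hlim : Tendsto (fun E => C * (C * |E - E₀|) * L) (𝓝 E₀) (𝓝 0) := by
    have : Continuous fun E => C * (C * |E - E₀|) * L := by fun_prop
    simpa using this.tendsto E₀
  rw [ContinuousAt, tendsto_iff_norm_sub_tendsto_zero]
  refine squeeze_zero' (Eventually.of_forall fun _ => norm_nonneg _) ?_ hlim
  filter_upwards [Metric.ball_mem_nhds E₀ hε] with E hE
  have hE' : |E - E₀| < ε := by simpa [Real.dist_eq] using hE
  have hc : ∀ E', Continuous fun s => W E₀ s 0 i * W E' s 0 j := fun E' =>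
    ((hW E₀).1 0 i).mul ((hW E').1 0 j)
  rw [← intervalIntegral.integral_sub ((hc E).intervalIntegrable _ _)
    ((hc E₀).intervalIntegrable _ _), Real.norm_eq_abs]
  refine abs_integral_le_of_bound hL.le le_rfl (by positivity) fun s hs => ?_
  rw [← mul_sub, abs_mul]
  exact mul_le_mul (hb E hE' i s hs).1 (hb E hE' j s hs).2 (abs_nonneg _) hC.le

theorem isClockwise (hp : IsPotential p) (hW : ∀ E, IsFundamentalSolution p E (W E))
    {L : ℝ} (hL : 0 < L) : IsClockwise fun E => W E L := by
  intro E
  have hdet := (hW E).det_eq hp L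
  refine ⟨by rw [Matrix.det_fin_two]; linarith, ?_⟩
  have hc : ∀ i j, Continuous fun s => W E s 0 i * W E s 0 j := fun i j =>
    ((hW E).1 0 i).mul ((hW E).1 0 j)
  set I : Fin 2 → Fin 2 → ℝ := fun i j => ∫ s in (0:ℝ)..L, W E s 0 i * W E s 0 j with hI
  have hI01 : I 0 1 = I 1 0 := by simp only [hI, mul_comm]
  refine ⟨!![I 1 0, I 1 1; -I 0 0, -I 0 1], ?_, ?_, ?_⟩
  · simp [Matrix.trace_fin_two, hI01]
  · intro x y hxy
    have heq : wedgeForm (-!![I 1 0, I 1 1; -I 0 0, -I 0 1]) x y =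
        ∫ s in (0:ℝ)..L, (W E s 0 0 * x + W E s 0 1 * y) ^ 2 := by
      have e : ∀ s, (W E s 0 0 * x + W E s 0 1 * y) ^ 2 = x ^ 2 * (W E s 0 0 * W E s 0 0) +
          2 * (x * y) * (W E s 0 0 * W E s 0 1) + y ^ 2 * (W E s 0 1 * W E s 0 1) :=
        fun s => by ring
      simp only [e]
      rw [intervalIntegral.integral_add, intervalIntegral.integral_add]
      · simp only [intervalIntegral.integral_const_mul]
        simp [wedgeForm, hI, mul_comm (W E _ 0 1) (W E _ 0 0)]
        ring
      all_goals
        refine Continuous.intervalIntegrable ?_ _ _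
        have h0 := (hW E).1 0 0
        have h1 := (hW E).1 0 1
        fun_prop
    rw [heq]
    have hcont : Continuous fun s => W E s 0 0 * x + W E s 0 1 * y :=
      ((hW E).1 0 0).mul_const x |>.add (((hW E).1 0 1).mul_const y)
    refine intervalIntegral.integral_pos hL (hcont.pow 2).continuousOn
      (fun s _ => sq_nonneg _) ?_
    by_contra! hcon
    have hzero : ∀ s ∈ Icc 0 L, W E s 0 0 * x + W E s 0 1 * y = 0 := fun s hs =>
      pow_eq_zero_iff two_ne_zero |>.1 (le_antisymm (hcon s hs) (sq_nonneg _))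
    have hmid : L / 2 ∈ Ioo 0 L := ⟨by linarith, by linarith⟩
    have hd : HasDerivAt (fun s => W E s 0 0 * x + W E s 0 1 * y)
        (W E (L / 2) 1 0 * x + W E (L / 2) 1 1 * y) (L / 2) :=
      (((hW E).hasDerivAt_fst 0 _).mul_const x).add (((hW E).hasDerivAt_fst 1 _).mul_const y)
    have hd0 : HasDerivAt (fun s => W E s 0 0 * x + W E s 0 1 * y) 0 (L / 2) := by
      refine (hasDerivAt_const (L / 2) (0:ℝ)).congr_of_eventuallyEq ?_
      filter_upwards [Ioo_mem_nhds hmid.1 hmid.2] with s hs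
      exact hzero s ⟨hs.1.le, hs.2.le⟩
    have h1 := hd.unique hd0
    have h2 := hzero _ ⟨hmid.1.le, hmid.2.le⟩
    have h3 := (hW E).det_eq hp (L / 2)
    have hx : x = 0 := by
      linear_combination -x * h3 + W E (L / 2) 1 1 * h2 - W E (L / 2) 0 1 * h1
    have hy : y = 0 := by
      linear_combination -y * h3 + W E (L / 2) 0 0 * h1 - W E (L / 2) 1 0 * h2
    exact hxy.elim (· hx) (· hy)
  · intro i j
    have h := hasDerivAt_of_eq_add_mul (f := fun E => W E L i j)
      (Eventually.of_forall fun E' => variation_energy hp hW E E' L j i)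
      (((continuousAt_integral_energy hp hW E hL 1 j).const_mul _).sub
        ((continuousAt_integral_energy hp hW E hL 0 j).const_mul _))
    refine h.congr_deriv ?_
    fin_cases j <;> simp [Matrix.mul_apply, Fin.sum_univ_two, hI] <;> ring

end Spectral

/-! ### Algebra of `2 × 2` matrices -/

theorem wedgeForm_conj {S X Y : Matrix (Fin 2) (Fin 2) ℝ} (h : S * Y = X * S) (x y : ℝ) :
    S.det * wedgeForm Y x y =
      wedgeForm X (S 0 0 * x + S 0 1 * y) (S 1 0 * x + S 1 1 * y) := by
  have e : ∀ i j, (S * Y) i j = (X * S) i j := fun i j => by rw [h]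
  have e00 := e 0 0
  have e01 := e 0 1
  have e10 := e 1 0
  have e11 := e 1 1
  simp only [Matrix.mul_apply, Fin.sum_univ_two] at e00 e01 e10 e11
  rw [Matrix.det_fin_two]
  unfold wedgeForm
  linear_combination (S 0 0 * x + S 0 1 * y) * (x * e10 + y * e11) -
    (S 1 0 * x + S 1 1 * y) * (x * e00 + y * e01)

theorem WedgePos.conj {S X Y : Matrix (Fin 2) (Fin 2) ℝ} (hX : WedgePos X)
    (h : S * Y = X * S) (hS : 0 < S.det) : WedgePos Y := by
  intro x y hxy
  have h1 := wedgeForm_conj h x y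
  have h2 : 0 < wedgeForm X (S 0 0 * x + S 0 1 * y) (S 1 0 * x + S 1 1 * y) := by
    apply hX
    by_contra! hcon
    have hx : S.det * x = 0 := by
      rw [Matrix.det_fin_two]
      linear_combination S 1 1 * hcon.1 - S 0 1 * hcon.2
    have hy : S.det * y = 0 := by
      rw [Matrix.det_fin_two]
      linear_combination S 0 0 * hcon.2 - S 1 0 * hcon.1
    exact hxy.elim (· ((mul_eq_zero.1 hx).resolve_left hS.ne'))
      (· ((mul_eq_zero.1 hy).resolve_left hS.ne'))
  rw [← h1] at h2
  exact pos_of_mul_pos_right h2 hS.le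

theorem WedgePos.apply_one_zero_pos {X : Matrix (Fin 2) (Fin 2) ℝ} (hX : WedgePos X) :
    0 < X 1 0 := by
  simpa [wedgeForm] using hX 1 0 (Or.inl one_ne_zero)

theorem WedgePos.apply_zero_one_neg {X : Matrix (Fin 2) (Fin 2) ℝ} (hX : WedgePos X) :
    X 0 1 < 0 := by
  simpa [wedgeForm] using hX 0 1 (Or.inr one_ne_zero)

theorem exists_eigenvector {M : Matrix (Fin 2) (Fin 2) ℝ} {l m : ℝ} (htr : M.trace = l + m)
    (hdet : M.det = l * m) : ∃ v : Fin 2 → ℝ, v ≠ 0 ∧ M *ᵥ v = l • v := by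
  have h0 : (M - l • (1 : Matrix (Fin 2) (Fin 2) ℝ)).det = 0 := by
    rw [Matrix.trace_fin_two] at htr
    rw [Matrix.det_fin_two] at hdet ⊢
    simp
    linear_combination hdet - l * htr
  obtain ⟨v, hv, h⟩ := Matrix.exists_mulVec_eq_zero_iff.2 h0
  refine ⟨v, hv, ?_⟩
  rw [Matrix.sub_mulVec, sub_eq_zero, Matrix.smul_mulVec, Matrix.one_mulVec] at h
  exact h

theorem exists_diagonalization {M : Matrix (Fin 2) (Fin 2) ℝ} {l m : ℝ} (htr : M.trace = l + m)
    (hdet : M.det = l * m) (hlm : l ≠ m) :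
    ∃ S : Matrix (Fin 2) (Fin 2) ℝ, 0 < S.det ∧ M * S = S * !![l, 0; 0, m] := by
  obtain ⟨v, hv, hMv⟩ := exists_eigenvector htr hdet
  obtain ⟨y, hy, hMy⟩ := exists_eigenvector (htr.trans (add_comm _ _)) (hdet.trans (mul_comm _ _))
  have hv0 := congrFun hMv 0
  have hv1 := congrFun hMv 1
  have hy0 := congrFun hMy 0
  have hy1 := congrFun hMy 1
  simp only [Matrix.mulVec, dotProduct, Fin.sum_univ_two, Pi.smul_apply, smul_eq_mul] at *
  have hne : v 0 * y 1 - v 1 * y 0 ≠ 0 := by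
    intro hd
    have key : ∀ i j, y i * v j = 0 := by
      have h0 : ∀ i j, y i * v j = v i * y j := by
        have two : ∀ l : Fin 2, l = 0 ∨ l = 1 := by decide
        intro i j
        rcases two i with rfl | rfl <;> rcases two j with rfl | rfl <;> linarith
      have two : ∀ l : Fin 2, l = 0 ∨ l = 1 := by decide
      intro i j
      have hj : M j 0 * v 0 + M j 1 * v 1 = l * v j := by
        rcases two j with rfl | rfl <;> assumption
      have hj' : M j 0 * y 0 + M j 1 * y 1 = m * y j := by
        rcases two j with rfl | rfl <;> assumption
      have : (l - m) * (y i * v j) = 0 := by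
        linear_combination -y i * hj + v i * hj' + M j 0 * h0 i 0 + M j 1 * h0 i 1 - m * h0 i j
      exact (mul_eq_zero.1 this).resolve_left (sub_ne_zero.2 hlm)
    obtain ⟨i, hi⟩ := Function.ne_iff.1 hy
    obtain ⟨j, hj⟩ := Function.ne_iff.1 hv
    exact mul_ne_zero hi hj (key i j)
  rcases lt_or_gt_of_ne hne with h | h
  · refine ⟨!![-v 0, y 0; -v 1, y 1], by simp [Matrix.det_fin_two]; linarith, ?_⟩
    ext i j
    fin_cases i <;> fin_cases j <;> simp [Matrix.mul_apply, Fin.sum_univ_two] <;> linarith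
  · refine ⟨!![v 0, y 0; v 1, y 1], by simp [Matrix.det_fin_two]; linarith, ?_⟩
    ext i j
    fin_cases i <;> fin_cases j <;> simp [Matrix.mul_apply, Fin.sum_univ_two] <;> linarith

theorem crossing_pos_of_diagonal {N A B : Matrix (Fin 2) (Fin 2) ℝ} {l m ε : ℝ}
    (hlm : l * m = 1) (hl : 1 < l ^ 2) (hA : A.trace = 0) (hA' : WedgePos (-A))
    (hB' : WedgePos (-B)) (hN' : WedgePos (ε • N))
    (hf : (!![l, 0; 0, m] * N).trace = m * N.trace) :
    0 < ε * l * ((!![l, 0; 0, m] * A * N).trace + (!![l, 0; 0, m] * N * B).trace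
      - ((!![l, 0; 0, m] * A).trace * m / (m - l) * N.trace + m * (N * B).trace)) := by
  have hne : m - l ≠ 0 := by
    intro h
    have : m = l := by linarith
    subst this
    nlinarith
  have a1 := hA'.apply_one_zero_pos
  have a2 := hA'.apply_zero_one_neg
  have b1 := hB'.apply_one_zero_pos
  have n1 := hN'.apply_one_zero_pos
  have n2 := hN'.apply_zero_one_neg
  simp only [Matrix.neg_apply, Matrix.smul_apply, smul_eq_mul] at a1 a2 b1 n1 n2
  rw [Matrix.trace_fin_two] at hA
  simp only [Matrix.trace_fin_two, Matrix.mul_apply, Fin.sum_univ_two] at hf ⊢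
  simp at hf ⊢
  have hn11 : N 0 0 = 0 := by
    have : (m - l) * N 0 0 = 0 := by linarith
    exact (mul_eq_zero.1 this).resolve_left hne
  have hA1 : A 1 1 = -A 0 0 := by linarith
  have hfrac : (l * A 0 0 + m * A 1 1) * m / (m - l) = -(A 0 0 * m) := by
    rw [hA1]
    field_simp
    ring
  rw [hfrac, hn11, hA1]
  have h1 : 0 < (ε * N 1 0) * (A 0 1) * l ^ 2 := by
    have : 0 < A 0 1 := by linarith
    have : 0 < l ^ 2 := by linarith
    positivity
  have h2 : 0 < (-(ε * N 0 1)) * (-A 1 0) :=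
    mul_pos (by linarith) (by linarith)
  have h3 : 0 < (-(ε * N 0 1)) * (-B 1 0) * (l ^ 2 - 1) :=
    mul_pos (mul_pos (by linarith) (by linarith)) (by linarith)
  have : ∀ z, z = (ε * N 1 0) * (A 0 1) * l ^ 2 + (-(ε * N 0 1)) * (-A 1 0) +
      (-(ε * N 0 1)) * (-B 1 0) * (l ^ 2 - 1) → 0 < z := fun z hz => by linarith
  apply this
  linear_combination (ε * (N 0 1 * A 1 0 - N 0 1 * B 1 0)) * hlm

/-- At an energy where `N` maps the expanding direction of `M` to the contracting one, the
crossing has a definite sign. -/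
theorem crossing_pos {M N A B : Matrix (Fin 2) (Fin 2) ℝ} {l m ε : ℝ}
    (htr : M.trace = l + m) (hdet : M.det = l * m)
    (hlm : l * m = 1) (hl : 1 < l ^ 2) (hA : A.trace = 0) (hA' : WedgePos (-A))
    (hB' : WedgePos (-B)) (hN' : WedgePos (ε • N))
    (hf : (M * N).trace = m * N.trace) :
    0 < ε * l * ((M * A * N).trace + (M * N * B).trace
      - ((M * A).trace * m / (m - l) * N.trace + m * (N * B).trace)) := by
  have hne : l ≠ m := by
    rintro rfl
    nlinarith
  obtain ⟨S, hS, hMS⟩ := exists_diagonalization htr hdet hne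
  have hu : IsUnit S.det := hS.ne'.isUnit
  have c : ∀ X, S * (S⁻¹ * X * S) = X * S := fun X => by
    rw [Matrix.mul_assoc, ← Matrix.mul_assoc S, Matrix.mul_nonsing_inv _ hu, Matrix.one_mul]
  have t : ∀ X, (S⁻¹ * X * S).trace = X.trace := fun X => by
    rw [Matrix.mul_assoc, Matrix.trace_mul_comm, Matrix.mul_assoc, Matrix.mul_nonsing_inv _ hu,
      Matrix.mul_one]
  have mm : ∀ X Y, (S⁻¹ * X * S) * (S⁻¹ * Y * S) = S⁻¹ * (X * Y) * S := fun X Y => by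
    rw [Matrix.mul_assoc (S⁻¹ * X), c]
    simp only [Matrix.mul_assoc]
  have hD : S⁻¹ * M * S = !![l, 0; 0, m] := by
    rw [Matrix.mul_assoc, hMS, ← Matrix.mul_assoc, Matrix.nonsing_inv_mul _ hu, Matrix.one_mul]
  have h := crossing_pos_of_diagonal (N := S⁻¹ * N * S) (A := S⁻¹ * A * S) (B := S⁻¹ * B * S)
    (ε := ε) hlm hl (by rw [t, hA])
    (hA'.conj (by rw [Matrix.mul_neg, c, Matrix.neg_mul]) hS)
    (hB'.conj (by rw [Matrix.mul_neg, c, Matrix.neg_mul]) hS)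
    (hN'.conj (by rw [Matrix.mul_smul, c, Matrix.smul_mul]) hS)
    (by rw [← hD, mm, t, t, hf])
  rw [← hD] at h
  simpa only [mm, t] using h

theorem nilpotent_trace_mul_pos {P X Y : Matrix (Fin 2) (Fin 2) ℝ} (htr : P.trace = 0)
    (hdet : P.det = 0) (hP : P ≠ 0) (hX : WedgePos X) (hY : WedgePos Y) :
    0 < (P * X).trace * (P * Y).trace := by
  rw [Matrix.trace_fin_two] at htr
  rw [Matrix.det_fin_two] at hdet
  have h11 : P 1 1 = -P 0 0 := by linarith
  rw [h11] at hdet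
  have key : ∀ Z, P 1 0 * (P * Z).trace = -wedgeForm Z (P 0 0) (P 1 0) := fun Z => by
    simp only [Matrix.trace_fin_two, Matrix.mul_apply, Fin.sum_univ_two, h11, wedgeForm]
    linear_combination (-Z 1 0) * hdet
  by_cases h10 : P 1 0 = 0
  · have h00 : P 0 0 = 0 := by
      rw [h10] at hdet
      nlinarith
    have h01 : P 0 1 ≠ 0 := by
      intro h
      apply hP
      ext i j
      fin_cases i <;> fin_cases j <;> simp [h00, h, h10, h11]
    have tr : ∀ Z, (P * Z).trace = P 0 1 * Z 1 0 := fun Z => by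
      simp [Matrix.trace_fin_two, Matrix.mul_apply, Fin.sum_univ_two, h11, h00, h10]
    rw [tr, tr]
    have := mul_pos hX.apply_one_zero_pos hY.apply_one_zero_pos
    have h2 : 0 < P 0 1 ^ 2 := by positivity
    nlinarith
  · have h1 := key X
    have h2 := key Y
    have p1 := hX (P 0 0) (P 1 0) (Or.inr h10)
    have p2 := hY (P 0 0) (P 1 0) (Or.inr h10)
    have h3 : 0 < P 1 0 ^ 2 * ((P * X).trace * (P * Y).trace) := by
      have : P 1 0 ^ 2 * ((P * X).trace * (P * Y).trace) =
        (P 1 0 * (P * X).trace) * (P 1 0 * (P * Y).trace) := by ring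
      rw [this, h1, h2]
      nlinarith
    exact pos_of_mul_pos_right h3 (sq_nonneg _)

theorem edge_sign {M A N : Matrix (Fin 2) (Fin 2) ℝ} {ε : ℝ} (hdet : M.det = 1)
    (htr : M.trace ^ 2 = 4) (hM : M ≠ (M.trace / 2) • 1) (hA : A.trace = 0)
    (hA' : WedgePos (-A)) (hN : WedgePos (ε • N)) :
    (M * A).trace * (ε * ((M * N).trace - M.trace / 2 * N.trace)) < 0 := by
  have h := nilpotent_trace_mul_pos (P := M - (M.trace / 2) • 1) (by
      simp [Matrix.trace_fin_two]) (by
      rw [Matrix.det_fin_two] at hdet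
      rw [Matrix.trace_fin_two] at htr
      simp [Matrix.det_fin_two, Matrix.trace_fin_two]
      linear_combination hdet - htr / 4) (sub_ne_zero.2 hM) hA' hN
  simp only [Matrix.sub_mul, Matrix.mul_neg, Matrix.trace_sub, Matrix.trace_neg,
    Matrix.smul_mul, Matrix.one_mul, Matrix.trace_smul, smul_eq_mul, hA, Matrix.mul_smul] at h
  linarith

theorem trace_mul_ne_zero {M A : Matrix (Fin 2) (Fin 2) ℝ} (hdet : M.det = 1)
    (htr : M.trace ^ 2 = 4) (hM : M ≠ (M.trace / 2) • 1) (hA : A.trace = 0)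
    (hA' : WedgePos (-A)) : (M * A).trace ≠ 0 := by
  have h := edge_sign (N := A) (ε := -1) hdet htr hM hA hA' (by simpa using hA')
  intro h0
  simp [h0] at h

theorem wedgePos_of_elliptic {N : Matrix (Fin 2) (Fin 2) ℝ} {ε : ℝ} (hdet : N.det = 1)
    (htr : N.trace ^ 2 < 4) (hε : 0 < ε * N 1 0) : WedgePos (ε • N) := by
  intro x y hxy
  rw [Matrix.det_fin_two] at hdet
  rw [Matrix.trace_fin_two] at htr
  have hN : N 1 0 ≠ 0 := right_ne_zero_of_mul hε.ne'
  have e : 4 * N 1 0 * wedgeForm N x y =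
      (2 * N 1 0 * x + (N 1 1 - N 0 0) * y) ^ 2 + (4 - (N 0 0 + N 1 1) ^ 2) * y ^ 2 := by
    unfold wedgeForm
    linear_combination (4 * y ^ 2) * hdet
  have hpos : 0 < 4 * N 1 0 * wedgeForm N x y := by
    rw [e]
    by_cases hy : y = 0
    · have hx : x ≠ 0 := hxy.resolve_right (not_not.2 hy)
      subst hy
      have : 2 * N 1 0 * x ≠ 0 := by positivity
      have : 0 < (2 * N 1 0 * x) ^ 2 := by positivity
      simpa using this
    · have : 0 < (4 - (N 0 0 + N 1 1) ^ 2) * y ^ 2 := mul_pos (by linarith) (by positivity)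
      positivity
  have e2 : wedgeForm (ε • N) x y = ε * wedgeForm N x y := by
    simp [wedgeForm]
    ring
  rw [e2]
  have h2 : 0 < (ε * N 1 0) * (N 1 0 * wedgeForm N x y) := mul_pos hε (by linarith)
  have h3 : (ε * N 1 0) * (N 1 0 * wedgeForm N x y) = (N 1 0) ^ 2 * (ε * wedgeForm N x y) := by
    ring
  rw [h3] at h2
  exact pos_of_mul_pos_right h2 (sq_nonneg _)

theorem elliptic_apply_ne_zero {N : Matrix (Fin 2) (Fin 2) ℝ} (hdet : N.det = 1)
    (htr : N.trace ^ 2 < 4) : N 1 0 ≠ 0 := by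
  intro h
  rw [Matrix.det_fin_two, h] at hdet
  rw [Matrix.trace_fin_two] at htr
  nlinarith [sq_nonneg (N 0 0 - N 1 1)]

/-! ### Gaps of a clockwise family -/

theorem eventually_pos_right_of_hasDerivAt {f : ℝ → ℝ} {f' x : ℝ} (h : HasDerivAt f f' x)
    (hx : f x = 0) (hf' : 0 < f') : ∀ᶠ y in 𝓝[>] x, 0 < f y := by
  have h1 := (hasDerivAt_iff_tendsto_slope.1 h).eventually (eventually_gt_nhds hf')
  have h2 : 𝓝[>] x ≤ 𝓝[≠] x := nhdsWithin_mono _ fun y hy => ne_of_gt hy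
  filter_upwards [h2 h1, self_mem_nhdsWithin] with y hy hxy
  rw [slope_def_field, hx, sub_zero] at hy
  exact (div_pos_iff_of_pos_right (sub_pos.2 hxy)).1 hy

theorem eventually_neg_left_of_hasDerivAt {f : ℝ → ℝ} {f' x : ℝ} (h : HasDerivAt f f' x)
    (hx : f x = 0) (hf' : 0 < f') : ∀ᶠ y in 𝓝[<] x, f y < 0 := by
  have h1 := (hasDerivAt_iff_tendsto_slope.1 h).eventually (eventually_gt_nhds hf')
  have h2 : 𝓝[<] x ≤ 𝓝[≠] x := nhdsWithin_mono _ fun y hy => ne_of_lt hy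
  filter_upwards [h2 h1, self_mem_nhdsWithin] with y hy hxy
  rw [slope_def_field, hx, sub_zero] at hy
  by_contra! hcon
  exact absurd (div_nonpos_of_nonneg_of_nonpos hcon (sub_nonpos.2 (le_of_lt hxy)))
    (not_le.2 hy)

theorem existsUnique_zero_of_deriv_pos {g : ℝ → ℝ} {x y : ℝ} (hxy : x < y)
    (hc : ContinuousOn g (Icc x y)) (hx : g x < 0) (hy : 0 < g y)
    (hd : ∀ z ∈ Ioo x y, g z = 0 → ∃ g', 0 < g' ∧ HasDerivAt g g' z) :
    ∃! z, z ∈ Ioo x y ∧ g z = 0 := by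
  obtain ⟨z, hz, hgz⟩ := intermediate_value_Ioo hxy.le hc ⟨hx, hy⟩
  have no_two : ∀ s t, s ∈ Ioo x y → t ∈ Ioo x y → g s = 0 → g t = 0 → ¬ s < t := by
    intro s t hs ht hgs hgt hst
    obtain ⟨d, hd0, hds⟩ := hd s hs hgs
    have h1 := eventually_pos_right_of_hasDerivAt hds hgs hd0
    obtain ⟨r, hr0, hr1⟩ := (h1.and (Ioo_mem_nhdsGT hst)).exists
    have hsub : Icc r t ⊆ Icc x y := Icc_subset_Icc (hs.1.trans hr1.1).le ht.2.le
    have hcomp : IsCompact (Icc r t ∩ g ⁻¹' Iic 0) := by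
      have := (hc.mono hsub).preimage_isClosed_of_isClosed isClosed_Icc isClosed_Iic (t := Iic 0)
      exact isCompact_Icc.of_isClosed_subset this inter_subset_left
    obtain ⟨w, ⟨hwI, hw0⟩, hwmin⟩ := hcomp.exists_isLeast
      ⟨t, right_mem_Icc.2 hr1.2.le, by simp [hgt]⟩
    have hrw : r < w := lt_of_le_of_ne hwI.1 fun h => by
      subst h
      exact absurd hw0 (not_le.2 hr0)
    have hpos : ∀ v ∈ Ioo r w, 0 < g v := fun v hv => by
      by_contra! hcon
      exact absurd (hwmin ⟨⟨hv.1.le, hv.2.le.trans hwI.2⟩, hcon⟩) (not_le.2 hv.2)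
    have hwxy : w ∈ Ioo x y := ⟨(hs.1.trans hr1.1).trans hrw, lt_of_le_of_lt hwI.2 ht.2⟩
    have hev : ∀ᶠ v in 𝓝[<] w, v ∈ Ioo r w := Ioo_mem_nhdsLT hrw
    have hgw : g w = 0 := by
      refine le_antisymm hw0 ?_
      have hcw : ContinuousAt g w := hc.continuousAt (Icc_mem_nhds hwxy.1 hwxy.2)
      exact ge_of_tendsto (hcw.tendsto.mono_left nhdsWithin_le_nhds)
        (hev.mono fun v hv => (hpos v hv).le)
    obtain ⟨d', hd0', hdw⟩ := hd w hwxy hgw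
    obtain ⟨v, hv1, hv2⟩ := ((eventually_neg_left_of_hasDerivAt hdw hgw hd0').and hev).exists
    exact absurd (hpos v hv2) (not_lt.2 hv1.le)
  refine ⟨z, ⟨hz, hgz⟩, fun w hw => ?_⟩
  rcases lt_trichotomy w z with h | h | h
  · exact (no_two w z hw.1 hz hw.2 hgz h).elim
  · exact h
  · exact (no_two z w hz hw.1 hgz hw.2 h).elim

theorem pos_or_neg_of_ne_zero {h : ℝ → ℝ} {x y : ℝ} (hc : ContinuousOn h (Icc x y))
    (h0 : ∀ z ∈ Icc x y, h z ≠ 0) :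
    ∃ ε : ℝ, (ε = 1 ∨ ε = -1) ∧ ∀ z ∈ Icc x y, 0 < ε * h z := by
  by_contra! hcon
  obtain ⟨s, hs, hs'⟩ := hcon 1 (Or.inl rfl)
  obtain ⟨t, ht, ht'⟩ := hcon (-1) (Or.inr rfl)
  obtain ⟨z, hz, hz0⟩ := isPreconnected_Icc.intermediate_value hs ht hc
    (show (0:ℝ) ∈ Icc (h s) (h t) from ⟨by linarith, by linarith⟩)
  exact h0 z hz hz0

section Clockwise

variable {M N : ℝ → Matrix (Fin 2) (Fin 2) ℝ}

theorem IsClockwise.hasDerivAt_trace {A : Matrix (Fin 2) (Fin 2) ℝ} {E : ℝ}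
    (hd : ∀ i j, HasDerivAt (fun E => M E i j) ((M E * A) i j) E) :
    HasDerivAt (fun E => (M E).trace) (M E * A).trace E := by
  simp only [Matrix.trace_fin_two]
  exact (hd 0 0).add (hd 1 1)

theorem IsClockwise.continuous_apply (hM : IsClockwise M) (i j : Fin 2) :
    Continuous fun E => M E i j :=
  continuous_iff_continuousAt.2 fun E => by
    obtain ⟨-, A, -, -, hd⟩ := hM E
    exact (hd i j).continuousAt

theorem IsClockwise.continuous_trace (hM : IsClockwise M) :
    Continuous fun E => (M E).trace := by
  simp only [Matrix.trace_fin_two]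
  exact (hM.continuous_apply 0 0).add (hM.continuous_apply 1 1)

/-- Near an energy with `M = ± 1` the family is elliptic. -/
theorem IsClockwise.eventually_lt_four (hM : IsClockwise M) {E : ℝ}
    (h : M E = ((M E).trace / 2) • 1) : ∀ᶠ E' in 𝓝[≠] E, (M E').trace ^ 2 < 4 := by
  obtain ⟨hdet, A, hA, hA', hd⟩ := hM E
  set c := (M E).trace / 2 with hc
  have hc2 : c ^ 2 = 1 := by
    rw [h, Matrix.det_fin_two] at hdet
    simpa [sq] using hdet
  have e01 : M E 0 1 = 0 := by rw [h]; simp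
  have e10 : M E 1 0 = 0 := by rw [h]; simp
  have e00 : M E 0 0 = c := by rw [h]; simp
  have e11 : M E 1 1 = c := by rw [h]; simp
  rw [Matrix.trace_fin_two] at hA
  have hA1 : A 1 1 = -A 0 0 := by linarith
  have d00 := hd 0 0
  have d01 := hd 0 1
  have d10 := hd 1 0
  have d11 := hd 1 1
  rw [h] at d00 d01 d10 d11
  simp only [Matrix.smul_mul, Matrix.one_mul, Matrix.smul_apply, smul_eq_mul] at d00 d01 d10 d11
  have t := fun {f : ℝ → ℝ} {f' : ℝ} (hf : HasDerivAt f f' E) =>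
    hasDerivAt_iff_tendsto_slope.1 hf
  have hlim := ((t (d11.sub d00)).pow 2).add (((t d01).mul (t d10)).const_mul 4)
  have hneg : (c * A 1 1 - c * A 0 0) ^ 2 + 4 * (c * A 0 1 * (c * A 1 0)) < 0 := by
    have hf := hA' (A 0 0) (A 1 0)
      (Or.inr (by have := hA'.apply_one_zero_pos; simp at this; exact this.ne))
    have h10 := hA'.apply_one_zero_pos
    simp [wedgeForm, hA1] at hf h10
    have : (A 0 0) ^ 2 + A 0 1 * A 1 0 < 0 := by
      have : 0 < (-A 1 0) * -((A 0 0) ^ 2 + A 0 1 * A 1 0) := by linarith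
      have := pos_of_mul_pos_right this (by linarith)
      linarith
    rw [hA1]
    nlinarith
  have hev := hlim.eventually (eventually_lt_nhds hneg)
  filter_upwards [hev, self_mem_nhdsWithin] with E' h1 hne
  have hne' : E' - E ≠ 0 := sub_ne_zero.2 hne
  simp only [slope_def_field, e00, e01, e10, e11, sub_zero, Pi.sub_apply] at h1
  have hdet' := (hM E').1
  rw [Matrix.det_fin_two] at hdet'
  rw [Matrix.trace_fin_two]
  have e : ((M E' 1 1 - M E' 0 0 - (c - c)) / (E' - E)) ^ 2 +
      4 * (M E' 0 1 / (E' - E) * (M E' 1 0 / (E' - E))) =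
      ((M E' 0 0 + M E' 1 1) ^ 2 - 4) / (E' - E) ^ 2 := by
    field_simp
    linear_combination -4 * hdet'
  rw [e, div_neg_iff] at h1
  rcases h1 with h1 | h1
  · exact absurd h1.2 (not_lt.2 (sq_nonneg _))
  · linarith [h1.1]

theorem IsClockwise.eventually_right (hM : IsClockwise M) (E : ℝ) :
    (∀ᶠ E' in 𝓝[>] E, 4 < (M E').trace ^ 2) ∨ ∀ᶠ E' in 𝓝[>] E, (M E').trace ^ 2 ≤ 4 := by
  have hc : Continuous fun E => (M E).trace ^ 2 := hM.continuous_trace.pow 2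
  have h2 : 𝓝[>] E ≤ 𝓝[≠] E := nhdsWithin_mono _ fun y hy => ne_of_gt hy
  rcases lt_trichotomy ((M E).trace ^ 2) 4 with h | h | h
  · exact Or.inr (nhdsWithin_le_nhds ((hc.tendsto E).eventually (eventually_le_nhds h)))
  · by_cases hP : M E = ((M E).trace / 2) • 1
    · exact Or.inr (((hM.eventually_lt_four hP).filter_mono h2).mono fun _ h => h.le)
    · obtain ⟨hdet, A, hA, hA', hd⟩ := hM E
      have hne := trace_mul_ne_zero hdet h hP hA hA'
      have hk : HasDerivAt (fun E => (M E).trace ^ 2 - 4)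
          (2 * (M E).trace * (M E * A).trace) E :=
        (((IsClockwise.hasDerivAt_trace hd).pow 2).sub_const 4).congr_deriv (by simp)
      have htr0 : (M E).trace ≠ 0 := by
        intro h0
        norm_num [h0] at h
      have hne2 : 2 * (M E).trace * (M E * A).trace ≠ 0 :=
        mul_ne_zero (mul_ne_zero two_ne_zero htr0) hne
      rcases lt_or_gt_of_ne hne2 with h' | h'
      · right
        have := eventually_pos_right_of_hasDerivAt hk.neg (by simp [h]) (neg_pos.2 h')
        exact this.mono fun _ hx => by simp at hx; exact hx.le
      · left
        have := eventually_pos_right_of_hasDerivAt hk (by simp [h]) h'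
        exact this.mono fun _ hx => by linarith
  · exact Or.inl (nhdsWithin_le_nhds ((hc.tendsto E).eventually (eventually_gt_nhds h)))

theorem IsClockwise.eventually_left (hM : IsClockwise M) (E : ℝ) :
    (∀ᶠ E' in 𝓝[<] E, 4 < (M E').trace ^ 2) ∨ ∀ᶠ E' in 𝓝[<] E, (M E').trace ^ 2 ≤ 4 := by
  have hc : Continuous fun E => (M E).trace ^ 2 := hM.continuous_trace.pow 2
  have h2 : 𝓝[<] E ≤ 𝓝[≠] E := nhdsWithin_mono _ fun y hy => ne_of_lt hy
  rcases lt_trichotomy ((M E).trace ^ 2) 4 with h | h | h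
  · exact Or.inr (nhdsWithin_le_nhds ((hc.tendsto E).eventually (eventually_le_nhds h)))
  · by_cases hP : M E = ((M E).trace / 2) • 1
    · exact Or.inr (((hM.eventually_lt_four hP).filter_mono h2).mono fun _ h => h.le)
    · obtain ⟨hdet, A, hA, hA', hd⟩ := hM E
      have hne := trace_mul_ne_zero hdet h hP hA hA'
      have hk : HasDerivAt (fun E => (M E).trace ^ 2 - 4)
          (2 * (M E).trace * (M E * A).trace) E :=
        (((IsClockwise.hasDerivAt_trace hd).pow 2).sub_const 4).congr_deriv (by simp)
      have htr0 : (M E).trace ≠ 0 := by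
        intro h0
        norm_num [h0] at h
      have hne2 : 2 * (M E).trace * (M E * A).trace ≠ 0 :=
        mul_ne_zero (mul_ne_zero two_ne_zero htr0) hne
      rcases lt_or_gt_of_ne hne2 with h' | h'
      · left
        have := eventually_neg_left_of_hasDerivAt hk.neg (by simp [h]) (neg_pos.2 h')
        exact this.mono fun _ hx => by simp at hx; exact hx
      · right
        have := eventually_neg_left_of_hasDerivAt hk (by simp [h]) h'
        exact this.mono fun _ hx => by linarith
  · exact Or.inl (nhdsWithin_le_nhds ((hc.tendsto E).eventually (eventually_gt_nhds h)))

end Clockwise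

theorem IsGap.subset {k : ℝ → ℝ} {G : Set ℝ} (h : IsGap k G) : G ⊆ {E | k E ^ 2 > 4} := by
  obtain ⟨-, E, -, rfl⟩ := h
  exact connectedComponentIn_subset _ _

theorem IsGap.eq_component {k : ℝ → ℝ} {G : Set ℝ} (h : IsGap k G) {E : ℝ} (hE : E ∈ G) :
    G = connectedComponentIn {E | k E ^ 2 > 4} E := by
  obtain ⟨-, E', -, rfl⟩ := h
  exact connectedComponentIn_eq hE

/-- Only finitely many gaps meet a compact interval. -/
theorem IsClockwise.finite_gaps {M : ℝ → Matrix (Fin 2) (Fin 2) ℝ} (hM : IsClockwise M) (x y : ℝ) :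
    {G : Set ℝ | IsGap (fun E => (M E).trace) G ∧ (G ∩ Icc x y).Nonempty}.Finite := by
  set F : Set ℝ := {E | (M E).trace ^ 2 > 4} with hF
  refine isCompact_Icc.induction_on
    (p := fun s => {G : Set ℝ | IsGap (fun E => (M E).trace) G ∧ (G ∩ s).Nonempty}.Finite)
    (by simp) (fun s t hst ht => ht.subset fun G hG => ⟨hG.1, hG.2.mono (by gcongr)⟩) ?_ ?_
  · intro s t hs ht
    refine (hs.union ht).subset fun G hG => ?_
    obtain ⟨hG1, z, hzG, hz | hz⟩ := hG
    · exact Or.inl ⟨hG1, z, hzG, hz⟩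
    · exact Or.inr ⟨hG1, z, hzG, hz⟩
  · intro E _
    have right : ∃ b > E, ∃ C : Set ℝ, ∀ G, IsGap (fun E => (M E).trace) G →
        (G ∩ Ioo E b).Nonempty → G = C := by
      rcases hM.eventually_right E with h | h
      all_goals obtain ⟨b, hb, hsub⟩ := mem_nhdsGT_iff_exists_Ioo_subset.1 h
      · refine ⟨b, hb, connectedComponentIn F ((E + b) / 2), fun G hG hne => ?_⟩
        obtain ⟨z, hzG, hz⟩ := hne
        have hmid : (E + b) / 2 ∈ Ioo E b := ⟨by linarith [hb.out], by linarith [hb.out]⟩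
        rw [hG.eq_component hzG]
        exact connectedComponentIn_eq
          (isPreconnected_Ioo.subset_connectedComponentIn hz hsub hmid)
      · refine ⟨b, hb, ∅, fun G hG hne => ?_⟩
        obtain ⟨z, hzG, hz⟩ := hne
        have h4 : 4 < (M z).trace ^ 2 := hG.subset hzG
        have h5 : (M z).trace ^ 2 ≤ 4 := hsub hz
        exact absurd h5 (not_le.2 h4)
    have left : ∃ b < E, ∃ C : Set ℝ, ∀ G, IsGap (fun E => (M E).trace) G →
        (G ∩ Ioo b E).Nonempty → G = C := by
      rcases hM.eventually_left E with h | h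
      all_goals obtain ⟨b, hb, hsub⟩ := mem_nhdsLT_iff_exists_Ioo_subset.1 h
      · refine ⟨b, hb, connectedComponentIn F ((b + E) / 2), fun G hG hne => ?_⟩
        obtain ⟨z, hzG, hz⟩ := hne
        have hmid : (b + E) / 2 ∈ Ioo b E := ⟨by linarith [hb.out], by linarith [hb.out]⟩
        rw [hG.eq_component hzG]
        exact connectedComponentIn_eq
          (isPreconnected_Ioo.subset_connectedComponentIn hz hsub hmid)
      · refine ⟨b, hb, ∅, fun G hG hne => ?_⟩
        obtain ⟨z, hzG, hz⟩ := hne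
        have h4 : 4 < (M z).trace ^ 2 := hG.subset hzG
        have h5 : (M z).trace ^ 2 ≤ 4 := hsub hz
        exact absurd h5 (not_le.2 h4)
    obtain ⟨b, hb, C, hC⟩ := right
    obtain ⟨b', hb', C', hC'⟩ := left
    refine ⟨Ioo b' b, nhdsWithin_le_nhds (Ioo_mem_nhds hb' hb),
      (Set.toFinite {C, C', connectedComponentIn F E}).subset fun G hG => ?_⟩
    obtain ⟨hG1, z, hzG, hz⟩ := hG
    rcases lt_trichotomy z E with h | h | h
    · exact Or.inr (Or.inl (hC' G hG1 ⟨z, hzG, hz.1, h⟩))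
    · subst h
      exact Or.inr (Or.inr (hG1.eq_component hzG))
    · exact Or.inl (hC G hG1 ⟨z, hzG, h, hz.2⟩)

theorem IsGap.exists_eq_Ioo {k : ℝ → ℝ} {G : Set ℝ} (h : IsGap k G) (hk : Continuous k) :
    ∃ x y σ : ℝ, x < y ∧ G = Ioo x y ∧ (σ = 1 ∨ σ = -1) ∧ (∀ E ∈ Ioo x y, 2 < σ * k E) ∧
      σ * k x = 2 ∧ σ * k y = 2 := by
  have hbdd := h.1
  have hsub := h.subset
  have heq := fun E => h.eq_component (E := E)
  obtain ⟨-, E, hE, hG⟩ := h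
  have hEG : E ∈ G := hG ▸ mem_connectedComponentIn hE
  have hpre : IsPreconnected G := hG ▸ isPreconnected_connectedComponentIn
  have hFo : IsOpen {E | k E ^ 2 > 4} := isOpen_lt continuous_const (hk.pow 2)
  have hGo : IsOpen G := hG ▸ hFo.connectedComponentIn
  have hne : G.Nonempty := ⟨E, hEG⟩
  set x := sInf G with hx
  set y := sSup G with hy
  have hxl : ∀ z ∈ G, x < z := fun z hz => by
    refine lt_of_le_of_ne (csInf_le hbdd.bddBelow hz) fun hxz => ?_
    obtain ⟨w, hw, h1⟩ := (((hGo.eventually_mem hz).filter_mono nhdsWithin_le_nhds).and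
      (eventually_mem_nhdsWithin (a := z) (s := Iio z))).exists
    have h1 : w < z := h1
    have h2 : x ≤ w := csInf_le hbdd.bddBelow hw
    linarith
  have hyl : ∀ z ∈ G, z < y := fun z hz => by
    refine lt_of_le_of_ne (le_csSup hbdd.bddAbove hz) fun hxz => ?_
    obtain ⟨w, hw, h1⟩ := (((hGo.eventually_mem hz).filter_mono nhdsWithin_le_nhds).and
      (eventually_mem_nhdsWithin (a := z) (s := Ioi z))).exists
    have h1 : z < w := h1
    have h2 : w ≤ y := le_csSup hbdd.bddAbove hw
    linarith
  have hxy : x < y := (hxl E hEG).trans (hyl E hEG)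
  have hGI : G = Ioo x y := by
    refine Subset.antisymm (fun z hz => ⟨hxl z hz, hyl z hz⟩) fun z hz => ?_
    obtain ⟨s, hs, hsz⟩ := exists_lt_of_csInf_lt hne hz.1
    obtain ⟨t, ht, htz⟩ := exists_lt_of_lt_csSup hne hz.2
    exact hpre.Icc_subset hs ht ⟨hsz.le, htz.le⟩
  have hedge : ∀ e, e = x ∨ e = y → ¬ 4 < k e ^ 2 := by
    intro e he h4
    have hmid : (x + y) / 2 ∈ Ioo x y := ⟨by linarith, by linarith⟩
    have hs : insert e (Ioo x y) ⊆ {E | k E ^ 2 > 4} := insert_subset h4 (hGI ▸ hsub)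
    have hcon : IsPreconnected (insert e (Ioo x y)) := by
      refine isPreconnected_Ioo.subset_closure (subset_insert _ _) ?_
      rw [closure_Ioo hxy.ne]
      refine insert_subset ?_ Ioo_subset_Icc_self
      rcases he with rfl | rfl
      · exact left_mem_Icc.2 hxy.le
      · exact right_mem_Icc.2 hxy.le
    have := hcon.subset_connectedComponentIn (Or.inr hmid) hs (mem_insert e _)
    rw [← heq _ (hGI ▸ hmid), hGI] at this
    rcases he with rfl | rfl
    · exact lt_irrefl _ this.1
    · exact lt_irrefl _ this.2
  have hsign : ∃ σ : ℝ, (σ = 1 ∨ σ = -1) ∧ ∀ E ∈ Ioo x y, 2 < σ * k E := by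
    by_contra! hcon
    obtain ⟨s, hs, hs'⟩ := hcon 1 (Or.inl rfl)
    obtain ⟨t, ht, ht'⟩ := hcon (-1) (Or.inr rfl)
    have h4s : 4 < k s ^ 2 := hsub (hGI ▸ hs)
    have h4t : 4 < k t ^ 2 := hsub (hGI ▸ ht)
    obtain ⟨z, hz, hz0⟩ := isPreconnected_Ioo.intermediate_value hs ht hk.continuousOn
      (show (0:ℝ) ∈ Icc (k s) (k t) from ⟨by nlinarith, by nlinarith⟩)
    have h4z : 4 < k z ^ 2 := hsub (hGI ▸ hz)
    norm_num [hz0] at h4z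
  obtain ⟨σ, hσ, hσk⟩ := hsign
  have hcl : ∀ e ∈ Icc x y, 2 ≤ σ * k e := by
    intro e he
    have : Icc x y ⊆ {e | 2 ≤ σ * k e} := by
      rw [← closure_Ioo hxy.ne]
      exact closure_minimal (fun z hz => (hσk z hz).le)
        (isClosed_le continuous_const (hk.const_mul σ))
    exact this he
  have hfin : ∀ e ∈ Icc x y, ¬ 4 < k e ^ 2 → σ * k e = 2 := by
    intro e he h4
    have h1 := hcl e he
    have h2 : (σ * k e) ^ 2 = k e ^ 2 := by rcases hσ with rfl | rfl <;> ring
    nlinarith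
  exact ⟨x, y, σ, hxy, hGI, hσ, hσk, hfin x (left_mem_Icc.2 hxy.le) (hedge x (Or.inl rfl)),
    hfin y (right_mem_Icc.2 hxy.le) (hedge y (Or.inr rfl))⟩

/-- The eigenvalue of modulus less than one of a hyperbolic matrix in `SL(2, ℝ)` with trace `k`,
where `σ` is the sign of `k`. -/
noncomputable def contractingEigenvalue (σ k : ℝ) : ℝ := k / 2 - σ * √(k ^ 2 / 4 - 1)

theorem contractingEigenvalue_spec {σ k : ℝ} (hσ : σ = 1 ∨ σ = -1) (hk : 2 < σ * k) :
    ∃ l : ℝ, l + contractingEigenvalue σ k = k ∧ l * contractingEigenvalue σ k = 1 ∧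
      1 < l ^ 2 ∧ 0 < σ * l := by
  have hσ2 : σ ^ 2 = 1 := by rcases hσ with rfl | rfl <;> norm_num
  have hk2 : 4 < k ^ 2 := by
    have : (σ * k) ^ 2 = k ^ 2 := by rw [mul_pow, hσ2, one_mul]
    nlinarith
  have hs : 0 < √(k ^ 2 / 4 - 1) := Real.sqrt_pos.2 (by linarith)
  have hs2 : √(k ^ 2 / 4 - 1) ^ 2 = k ^ 2 / 4 - 1 := Real.sq_sqrt (by linarith)
  have h1 : σ * (k / 2 + σ * √(k ^ 2 / 4 - 1)) = σ * k / 2 + √(k ^ 2 / 4 - 1) := by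
    linear_combination √(k ^ 2 / 4 - 1) * hσ2
  refine ⟨k / 2 + σ * √(k ^ 2 / 4 - 1), ?_, ?_, ?_, ?_⟩
  · unfold contractingEigenvalue
    ring
  · unfold contractingEigenvalue
    linear_combination -√(k ^ 2 / 4 - 1) ^ 2 * hσ2 - hs2
  · have : (σ * (k / 2 + σ * √(k ^ 2 / 4 - 1))) ^ 2 = (k / 2 + σ * √(k ^ 2 / 4 - 1)) ^ 2 := by
      rw [mul_pow, hσ2, one_mul]
    rw [← this, h1]
    nlinarith
  · rw [h1]
    linarith

/-- In a gap of `M` along which `N` stays elliptic, `N` maps the expanding direction of `M` to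
the contracting one at exactly one energy. -/
theorem existsUnique_crossing {M N : ℝ → Matrix (Fin 2) (Fin 2) ℝ} (hM : IsClockwise M)
    (hN : IsClockwise N) {x y σ : ℝ} (hxy : x < y) (hσ : σ = 1 ∨ σ = -1)
    (hk : ∀ E ∈ Ioo x y, 2 < σ * (M E).trace) (hx : σ * (M x).trace = 2)
    (hy : σ * (M y).trace = 2) (hell : ∀ E ∈ Icc x y, (N E).trace ^ 2 < 4) :
    ∃! E, E ∈ Ioo x y ∧
      (M E * N E).trace = contractingEigenvalue σ (M E).trace * (N E).trace := by
  have hσ2 : σ ^ 2 = 1 := by rcases hσ with rfl | rfl <;> norm_num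
  obtain ⟨ε, hε, hεN⟩ := pos_or_neg_of_ne_zero (hN.continuous_apply 1 0).continuousOn
    fun E hE => elliptic_apply_ne_zero (hN E).1 (hell E hE)
  have hε2 : ε ^ 2 = 1 := by rcases hε with rfl | rfl <;> norm_num
  have hNpos : ∀ E ∈ Icc x y, WedgePos (ε • N E) := fun E hE =>
    wedgePos_of_elliptic (hN E).1 (hell E hE) (hεN E hE)
  set g : ℝ → ℝ := fun E => ε * σ * ((M E * N E).trace -
    contractingEigenvalue σ (M E).trace * (N E).trace) with hg
  have hiff : ∀ E, g E = 0 ↔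
      (M E * N E).trace = contractingEigenvalue σ (M E).trace * (N E).trace := by
    intro E
    have : ε * σ ≠ 0 := by
      rcases hε with rfl | rfl <;> rcases hσ with rfl | rfl <;> norm_num
    simp only [hg, mul_eq_zero, this, false_or, sub_eq_zero]
  simp only [← hiff]
  have hcM := hM.continuous_trace
  have hcN := hN.continuous_trace
  have hcMN : Continuous fun E => (M E * N E).trace := by
    simp only [Matrix.trace_fin_two, Matrix.mul_apply, Fin.sum_univ_two]
    have := hM.continuous_apply
    have := hN.continuous_apply
    fun_prop
  have hgc : Continuous g := by
    simp only [hg, contractingEigenvalue]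
    fun_prop
  have htr2 : ∀ e, σ * (M e).trace = 2 → (M e).trace ^ 2 = 4 := fun e he => by
    linear_combination (-(M e).trace ^ 2) * hσ2 + (σ * (M e).trace + 2) * he
  have hedge : ∀ e, σ * (M e).trace = 2 → g e =
      σ * (ε * ((M e * N e).trace - (M e).trace / 2 * (N e).trace)) := by
    intro e he
    have h0 : (M e).trace ^ 2 / 4 - 1 = 0 := by
      rw [htr2 e he]
      norm_num
    simp only [hg, contractingEigenvalue, h0, Real.sqrt_zero, mul_zero, sub_zero]
    ring
  have hgx : g x < 0 := by
    obtain ⟨hdet, A, hA, hA', hd⟩ := hM x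
    have hev : ∀ᶠ E in 𝓝[>] x, E ∈ Ioo x y := Ioo_mem_nhdsGT hxy
    have hP : M x ≠ ((M x).trace / 2) • 1 := by
      intro hP
      have h2 : 𝓝[>] x ≤ 𝓝[≠] x := nhdsWithin_mono _ fun y hy => ne_of_gt hy
      obtain ⟨E, h1, h3⟩ := (((hM.eventually_lt_four hP).filter_mono h2).and hev).exists
      have h4 := hk E h3
      have : (σ * (M E).trace) ^ 2 = (M E).trace ^ 2 := by rw [mul_pow, hσ2, one_mul]
      nlinarith
    have hs := edge_sign hdet (htr2 x hx) hP hA hA' (hNpos x (left_mem_Icc.2 hxy.le))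
    have hne := trace_mul_ne_zero hdet (htr2 x hx) hP hA hA'
    have hpos : 0 < σ * (M x * A).trace := by
      by_contra! hcon
      have hlt : σ * (M x * A).trace < 0 := lt_of_le_of_ne hcon
        (mul_ne_zero (by rcases hσ with rfl | rfl <;> norm_num) hne)
      have hdk : HasDerivAt (fun E => -(σ * (M E).trace - 2)) (-(σ * (M x * A).trace)) x :=
        (((IsClockwise.hasDerivAt_trace hd).const_mul σ).sub_const 2).neg
      obtain ⟨E, h1, h3⟩ := ((eventually_pos_right_of_hasDerivAt hdk (by linarith)
        (by linarith)).and hev).exists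
      linarith [hk E h3]
    rw [hedge x hx]
    have h5 : (σ * (M x * A).trace) *
        (σ * (ε * ((M x * N x).trace - (M x).trace / 2 * (N x).trace))) < 0 := by
      have : ∀ u v : ℝ, (σ * u) * (σ * v) = u * v := fun u v => by
        linear_combination u * v * hσ2
      rw [this]
      exact hs
    exact (pos_iff_neg_of_mul_neg h5).1 hpos
  have hgy : 0 < g y := by
    obtain ⟨hdet, A, hA, hA', hd⟩ := hM y
    have hev : ∀ᶠ E in 𝓝[<] y, E ∈ Ioo x y := Ioo_mem_nhdsLT hxy
    have hP : M y ≠ ((M y).trace / 2) • 1 := by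
      intro hP
      have h2 : 𝓝[<] y ≤ 𝓝[≠] y := nhdsWithin_mono _ fun y hy => ne_of_lt hy
      obtain ⟨E, h1, h3⟩ := (((hM.eventually_lt_four hP).filter_mono h2).and hev).exists
      have h4 := hk E h3
      have : (σ * (M E).trace) ^ 2 = (M E).trace ^ 2 := by rw [mul_pow, hσ2, one_mul]
      nlinarith
    have hs := edge_sign hdet (htr2 y hy) hP hA hA' (hNpos y (right_mem_Icc.2 hxy.le))
    have hne := trace_mul_ne_zero hdet (htr2 y hy) hP hA hA'
    have hneg : σ * (M y * A).trace < 0 := by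
      by_contra! hcon
      have hlt : 0 < σ * (M y * A).trace := lt_of_le_of_ne hcon
        (mul_ne_zero (by rcases hσ with rfl | rfl <;> norm_num) hne).symm
      have hdk : HasDerivAt (fun E => σ * (M E).trace - 2) (σ * (M y * A).trace) y :=
        ((IsClockwise.hasDerivAt_trace hd).const_mul σ).sub_const 2
      obtain ⟨E, h1, h3⟩ := ((eventually_neg_left_of_hasDerivAt hdk (by linarith)
        (by linarith)).and hev).exists
      linarith [hk E h3]
    rw [hedge y hy]
    have h5 : (σ * (M y * A).trace) *
        (σ * (ε * ((M y * N y).trace - (M y).trace / 2 * (N y).trace))) < 0 := by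
      have : ∀ u v : ℝ, (σ * u) * (σ * v) = u * v := fun u v => by
        linear_combination u * v * hσ2
      rw [this]
      exact hs
    exact (neg_iff_pos_of_mul_neg h5).1 hneg
  refine existsUnique_zero_of_deriv_pos hxy hgc.continuousOn hgx hgy fun E hE hE0 => ?_
  obtain ⟨hdet, A, hA, hA', hd⟩ := hM E
  obtain ⟨hdetN, B, hB, hB', hdN⟩ := hN E
  obtain ⟨l, hl1, hl2, hl3, hl4⟩ := contractingEigenvalue_spec hσ (hk E hE)
  set m := contractingEigenvalue σ (M E).trace with hm
  have hcross := crossing_pos (ε := ε) hl1.symm (hdet.trans hl2.symm) hl2 hl3 hA hA' hB'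
    (hNpos E ⟨hE.1.le, hE.2.le⟩) ((hiff E).1 hE0)
  have hk2 : (M E).trace ^ 2 / 4 - 1 = ((l - m) / 2) ^ 2 := by
    rw [← hl1]
    linear_combination hl2
  have hlm : m - l ≠ 0 := by
    intro h
    have : m = l := by linarith
    rw [this] at hl2
    nlinarith
  have hk2' : (M E).trace ^ 2 / 4 - 1 ≠ 0 := by
    rw [hk2]
    have : l - m ≠ 0 := fun h => hlm (by linarith)
    positivity
  have hsq : σ * √((M E).trace ^ 2 / 4 - 1) = (l - m) / 2 := by
    have : m = (M E).trace / 2 - σ * √((M E).trace ^ 2 / 4 - 1) := rfl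
    linarith
  have dtr := IsClockwise.hasDerivAt_trace hd
  have dμ : HasDerivAt (fun E => contractingEigenvalue σ (M E).trace)
      ((M E * A).trace * m / (m - l)) E := by
    have h1 := ((((dtr.pow 2).div_const 4).sub_const 1).sqrt hk2').const_mul σ
    have h2 := (dtr.div_const 2).sub h1
    refine h2.congr_deriv ?_
    have hsq0 : √((M E).trace ^ 2 / 4 - 1) ≠ 0 :=
      (Real.sqrt_pos.2 (lt_of_le_of_ne (by rw [hk2]; positivity) hk2'.symm)).ne'
    have hσ0 : σ ≠ 0 := by rcases hσ with rfl | rfl <;> norm_num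
    have e : √((M E).trace ^ 2 / 4 - 1) = σ * ((l - m) / 2) := by
      rw [← hsq]
      linear_combination -√((M E).trace ^ 2 / 4 - 1) * hσ2
    simp only [e, Pi.pow_apply]
    have hlm' : l - m ≠ 0 := fun h => hlm (by linarith)
    rw [← hl1]
    field_simp
    norm_num
    field_simp
    ring
  have dN := IsClockwise.hasDerivAt_trace hdN
  have dMN : HasDerivAt (fun E => (M E * N E).trace)
      ((M E * A * N E).trace + (M E * N E * B).trace) E := by
    have h2 : ∀ X Y : Matrix (Fin 2) (Fin 2) ℝ, (X * Y).trace =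
        X 0 0 * Y 0 0 + X 0 1 * Y 1 0 + (X 1 0 * Y 0 1 + X 1 1 * Y 1 1) := fun X Y => by
      simp only [Matrix.trace_fin_two, Matrix.mul_apply, Fin.sum_univ_two]
    have h3 : (fun E => (M E * N E).trace) = fun E => M E 0 0 * N E 0 0 + M E 0 1 * N E 1 0 +
        (M E 1 0 * N E 0 1 + M E 1 1 * N E 1 1) := funext fun E => h2 _ _
    rw [Matrix.mul_assoc (M E) (N E) B, h2 (M E * A), h2 (M E) (N E * B), h3]
    refine ((((hd 0 0).mul (hdN 0 0)).add ((hd 0 1).mul (hdN 1 0))).add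
      (((hd 1 0).mul (hdN 0 1)).add ((hd 1 1).mul (hdN 1 1)))).congr_deriv ?_
    ring
  have dg := (dMN.sub (dμ.mul dN)).const_mul (ε * σ)
  refine ⟨_, ?_, dg⟩
  have h6 := mul_pos hcross hl4
  have h7 : 0 < l ^ 2 := by linarith
  refine pos_of_mul_pos_right (a := l ^ 2) ?_ h7.le
  refine h6.trans_eq ?_
  ring

/-! ### Square integrability of quasi-periodic functions -/

section QuasiPeriodic

variable {h : ℝ → ℝ} {a μ : ℝ}

theorem integrableOn_comp_add_Iic {f : ℝ → ℝ} {b : ℝ} (hf : IntegrableOn f (Iic b))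
    (c : ℝ) : IntegrableOn (fun x => f (x + c)) (Iic (b - c)) := by
  have := (MeasurePreserving.integrableOn_comp_preimage (measurePreserving_add_right volume c)
    (measurableEmbedding_addRight c) (f := f) (s := Iic b)).2 hf
  simpa [Function.comp_def] using this

theorem integrableOn_comp_add_Ici {f : ℝ → ℝ} {b : ℝ} (hf : IntegrableOn f (Ici b))
    (c : ℝ) : IntegrableOn (fun x => f (x + c)) (Ici (b - c)) := by
  have := (MeasurePreserving.integrableOn_comp_preimage (measurePreserving_add_right volume c)
    (measurableEmbedding_addRight c) (f := f) (s := Ici b)).2 hf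
  simpa [Function.comp_def] using this

theorem integrableOn_comp_neg_iff {f : ℝ → ℝ} {b : ℝ} :
    IntegrableOn (fun x => f (-x)) (Iic (-b)) ↔ IntegrableOn f (Ici b) := by
  have := (MeasurePreserving.integrableOn_comp_preimage (Measure.measurePreserving_neg volume)
    (MeasurableEquiv.neg ℝ).measurableEmbedding (f := f) (s := Ici b))
  simpa [Function.comp_def] using this

theorem eq_zero_of_integrableOn_Iic (ha : 0 < a) (hh : Continuous h)
    (hq : ∀ x, h (x + a) = μ * h x) (hμ : μ ^ 2 < 1) {b : ℝ}
    (hi : IntegrableOn (fun x => h x ^ 2) (Iic b)) {x : ℝ} (hx : x < b) : h x = 0 := by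
  have h1 : ∫ x in Iic b, h x ^ 2 = μ ^ 2 * ∫ x in Iic (b - a), h x ^ 2 := by
    have := MeasurePreserving.setIntegral_preimage_emb (measurePreserving_add_right volume a)
      (measurableEmbedding_addRight a) (fun x => h x ^ 2) (Iic b)
    rw [← this, ← integral_const_mul]
    simp [hq, mul_pow]
  have h2 : ∫ x in Iic (b - a), h x ^ 2 ≤ ∫ x in Iic b, h x ^ 2 :=
    setIntegral_mono_set hi (ae_of_all _ fun x => sq_nonneg (h x))
      (Iic_subset_Iic.2 (by linarith)).eventuallyLE
  have h3 : 0 ≤ ∫ x in Iic b, h x ^ 2 := integral_nonneg fun x => sq_nonneg (h x)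
  have h4 : ∫ x in Iic b, h x ^ 2 = 0 := by
    nlinarith [mul_le_mul_of_nonneg_left h2 (sq_nonneg μ)]
  have h5 := (setIntegral_eq_zero_iff_of_nonneg_ae (ae_of_all _ fun x => sq_nonneg (h x)) hi).1 h4
  have h6 := Measure.eqOn_open_of_ae_eq (ae_restrict_of_ae_restrict_of_subset Iio_subset_Iic_self h5)
    isOpen_Iio (hh.pow 2).continuousOn continuousOn_const hx
  simpa using h6

theorem integrableOn_Iic_of_quasiPeriodic (ha : 0 < a) (hh : Continuous h)
    (hq : ∀ x, h (x + a) = μ * h x) (hμ : 1 < μ ^ 2) (b : ℝ) :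
    IntegrableOn (fun x => h x ^ 2) (Iic b) := by
  set γ := Real.log (μ ^ 2) / a with hγ
  have hγ0 : 0 < γ := div_pos (Real.log_pos hμ) ha
  set φ : ℝ → ℝ := fun x => h x ^ 2 * Real.exp (-(γ * x)) with hφ
  have hper : Function.Periodic φ a := by
    intro x
    have e : Real.exp (-(γ * (x + a))) = Real.exp (-(γ * x)) * (μ ^ 2)⁻¹ := by
      rw [← Real.exp_log (show 0 < μ ^ 2 by linarith), ← Real.exp_neg, ← Real.exp_add, hγ]
      congr 1
      field_simp
      ring
    simp only [hφ, hq, e]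
    have : μ ≠ 0 := by
      rintro rfl
      norm_num at hμ
    field_simp
  have hφc : Continuous φ := by fun_prop
  obtain ⟨C, hC⟩ := isCompact_Icc.exists_bound_of_continuousOn
    (hφc.continuousOn (s := Icc 0 a))
  have hb : ∀ x, h x ^ 2 ≤ C * Real.exp (γ * x) := by
    intro x
    obtain ⟨y, hy, hxy⟩ := hper.exists_mem_Ico₀ ha x
    have h1 := (le_abs_self _).trans (hC y (Ico_subset_Icc_self hy))
    rw [← hxy] at h1
    have h2 : h x ^ 2 = φ x * Real.exp (γ * x) := by
      simp only [hφ]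
      rw [mul_assoc, ← Real.exp_add]
      simp
    rw [h2]
    exact mul_le_mul_of_nonneg_right h1 (Real.exp_pos _).le
  refine ((integrableOn_exp_mul_Iic hγ0 b).const_mul C).mono' (by fun_prop)
    (ae_of_all _ fun x => ?_)
  rw [Real.norm_eq_abs, abs_of_nonneg (sq_nonneg _)]
  exact hb x

theorem eq_zero_of_integrableOn_Ici (ha : 0 < a) (hh : Continuous h)
    (hq : ∀ x, h (x + a) = μ * h x) (hμ : 1 < μ ^ 2) {b : ℝ}
    (hi : IntegrableOn (fun x => h x ^ 2) (Ici b)) {x : ℝ} (hx : b < x) : h x = 0 := by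
  have hμ0 : μ ≠ 0 := by
    rintro rfl
    norm_num at hμ
  have := eq_zero_of_integrableOn_Iic (h := fun x => h (-x)) (μ := μ⁻¹) (b := -b) (x := -x) ha
    (by fun_prop) (fun x => ?_) ?_ (integrableOn_comp_neg_iff.2 hi) (by linarith)
  · simpa using this
  · have := hq (-x - a)
    rw [sub_add_cancel] at this
    rw [this, neg_add, ← sub_eq_add_neg]
    field_simp
  · rw [inv_pow]
    exact inv_lt_one_of_one_lt₀ hμ

theorem integrableOn_Ici_of_quasiPeriodic (ha : 0 < a) (hh : Continuous h)
    (hq : ∀ x, h (x + a) = μ * h x) (hμ0 : μ ≠ 0) (hμ : μ ^ 2 < 1) (b : ℝ) :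
    IntegrableOn (fun x => h x ^ 2) (Ici b) := by
  refine integrableOn_comp_neg_iff.1 (integrableOn_Iic_of_quasiPeriodic (h := fun x => h (-x))
    (μ := μ⁻¹) ha (by fun_prop) (fun x => ?_) ?_ (-b))
  · have := hq (-x - a)
    rw [sub_add_cancel] at this
    rw [this, neg_add, ← sub_eq_add_neg]
    field_simp
  · rw [inv_pow]
    exact (one_lt_inv₀ (by positivity)).2 hμ

end QuasiPeriodic

/-! ### Solutions in terms of their initial data -/

section InitialData

variable {p : ℝ → ℝ} {E : ℝ} {W : ℝ → Matrix (Fin 2) (Fin 2) ℝ}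

theorem IsFundamentalSolution.solvesOn_mulVec (hp : IsPotential p)
    (hW : IsFundamentalSolution p E W) (v : Fin 2 → ℝ) :
    SolvesOn (fun x => p x - E) (fun x => (W x *ᵥ v) 0) (fun x => (W x *ᵥ v) 1) univ := by
  obtain ⟨h0, h0', S, hS, hd⟩ := hW.solvesOn hp 0
  obtain ⟨h1, h1', S', hS', hd'⟩ := hW.solvesOn hp 1
  simp only [Matrix.mulVec_eq_sum, Fin.sum_univ_two, Pi.add_apply, Pi.smul_apply,
    MulOpposite.smul_eq_mul_unop, MulOpposite.unop_op, Matrix.transpose_apply]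
  refine ⟨by fun_prop, by fun_prop, S ∪ S', hS.union hS', fun x hx => ?_⟩
  obtain ⟨e0, e0'⟩ := hd x ⟨hx.1, fun h => hx.2 (Or.inl h)⟩
  obtain ⟨e1, e1'⟩ := hd' x ⟨hx.1, fun h => hx.2 (Or.inr h)⟩
  exact ⟨(e0.mul_const (v 0)).add (e1.mul_const (v 1)),
    ((e0'.mul_const (v 0)).add (e1'.mul_const (v 1))).congr_deriv (by ring)⟩

theorem IsFundamentalSolution.eq_mulVec {u v : ℝ → ℝ} {x : ℝ}
    (hp : IsPotential p) (hW : IsFundamentalSolution p E W)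
    (h : SolvesOn (fun s => p s - E) u v (Ioo (min 0 x) (max 0 x))) :
    ![u x, v x] = W x *ᵥ ![u 0, v 0] := by
  obtain ⟨h1, h2⟩ := hW.eq_of_solvesOn hp h
  ext i
  fin_cases i
  · simpa [Matrix.mulVec, dotProduct, Fin.sum_univ_two] using h1
  · simpa [Matrix.mulVec, dotProduct, Fin.sum_univ_two] using h2

theorem IsFundamentalSolution.mulVec_add_period {a μ : ℝ} {y : Fin 2 → ℝ} (hp : IsPotential p)
    (hW : IsFundamentalSolution p E W) (hper : ∀ x, p (x + a) = p x)
    (hy : W a *ᵥ y = μ • y) (x : ℝ) : W (x + a) *ᵥ y = μ • (W x *ᵥ y) := by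
  rw [hW.add_period hp hper, ← Matrix.mulVec_mulVec, hy, Matrix.mulVec_smul]

theorem IsFundamentalSolution.eq_zero_of_mulVec (hp : IsPotential p)
    (hW : IsFundamentalSolution p E W) {y : Fin 2 → ℝ} {I : Set ℝ} (hI : IsOpen I)
    (hne : I.Nonempty) (h : ∀ x ∈ I, (W x *ᵥ y) 0 = 0) : y = 0 := by
  obtain ⟨x, hx⟩ := hne
  have hd : HasDerivAt (fun x => (W x *ᵥ y) 0) ((W x *ᵥ y) 1) x := by
    simp only [Matrix.mulVec, dotProduct, Fin.sum_univ_two]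
    exact ((hW.hasDerivAt_fst 0 x).mul_const _).add ((hW.hasDerivAt_fst 1 x).mul_const _)
  have hd0 : HasDerivAt (fun x => (W x *ᵥ y) 0) 0 x :=
    (hasDerivAt_const x (0 : ℝ)).congr_of_eventuallyEq (by
      filter_upwards [hI.mem_nhds hx] with z hz using h z hz)
  have h0 := h x hx
  have h1 := hd.unique hd0
  have hdet := hW.det_eq hp x
  simp only [Matrix.mulVec, dotProduct, Fin.sum_univ_two] at h0 h1
  ext i
  fin_cases i
  · simp only [Fin.zero_eta, Pi.zero_apply]
    linear_combination -y 0 * hdet + W x 1 1 * h0 - W x 0 1 * h1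
  · simp only [Fin.mk_one, Pi.zero_apply]
    linear_combination -y 1 * hdet - W x 1 0 * h0 + W x 0 0 * h1

end InitialData

/-- Solutions that match at `b` can be glued. -/
theorem SolvesOn.ite {p u v u' v' : ℝ → ℝ} {I : Set ℝ} {b : ℝ} (h : SolvesOn p u v (I ∩ Iio b))
    (h' : SolvesOn p u' v' (I ∩ Ioi b)) (hu : u b = u' b) (hv : v b = v' b) :
    SolvesOn p (fun x => if x ≤ b then u x else u' x) (fun x => if x ≤ b then v x else v' x) I := by
  obtain ⟨h0, h0', S, hS, hd⟩ := h
  obtain ⟨h1, h1', S', hS', hd'⟩ := h'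
  refine ⟨h0.if_le h1 continuous_id continuous_const fun x hx => by rwa [show x = b from hx],
    h0'.if_le h1' continuous_id continuous_const fun x hx => by rwa [show x = b from hx],
    S ∪ S' ∪ {b}, (hS.union hS').union (countable_singleton b), fun x hx => ?_⟩
  simp only [Set.mem_sdiff, mem_union, mem_singleton_iff, not_or] at hx
  rcases lt_or_gt_of_ne hx.2.2 with hxb | hxb
  · obtain ⟨e, e'⟩ := hd x ⟨⟨hx.1, hxb⟩, hx.2.1.1⟩
    have hev : ∀ᶠ y in 𝓝 x, y ≤ b := (eventually_lt_nhds hxb).mono fun _ => le_of_lt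
    simp only [if_pos hxb.le]
    exact ⟨e.congr_of_eventuallyEq (hev.mono fun y hy => if_pos hy),
      e'.congr_of_eventuallyEq (hev.mono fun y hy => if_pos hy)⟩
  · obtain ⟨e, e'⟩ := hd' x ⟨⟨hx.1, hxb⟩, hx.2.1.2⟩
    have hev : ∀ᶠ y in 𝓝 x, ¬ y ≤ b := (eventually_gt_nhds hxb).mono fun _ => not_le.2
    simp only [if_neg (not_le.2 hxb)]
    exact ⟨e.congr_of_eventuallyEq (hev.mono fun y hy => if_neg hy),
      e'.congr_of_eventuallyEq (hev.mono fun y hy => if_neg hy)⟩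

/-! ### Algebra of eigenvectors -/

theorem mul_mul_eq_trace_smul {Q N : Matrix (Fin 2) (Fin 2) ℝ} (hQ : Q.det = 0) :
    Q * N * Q = (Q * N).trace • Q := by
  rw [Matrix.det_fin_two] at hQ
  ext i j
  fin_cases i <;> fin_cases j <;>
    simp only [Matrix.trace_fin_two, Matrix.mul_apply, Fin.sum_univ_two, Matrix.smul_apply,
      smul_eq_mul, Fin.zero_eta, Fin.mk_one]
  · linear_combination -N 1 1 * hQ
  · linear_combination N 0 1 * hQ
  · linear_combination N 1 0 * hQ
  · linear_combination -N 0 0 * hQ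

theorem sub_smul_mulVec {M : Matrix (Fin 2) (Fin 2) ℝ} {l m : ℝ} (htr : M.trace = l + m)
    (hdet : M.det = l * m) (v : Fin 2 → ℝ) :
    M *ᵥ (M *ᵥ v - l • v) = m • (M *ᵥ v - l • v) := by
  rw [Matrix.trace_fin_two] at htr
  rw [Matrix.det_fin_two] at hdet
  ext i
  fin_cases i <;>
    simp only [Matrix.mulVec, dotProduct, Fin.sum_univ_two, Pi.sub_apply, Pi.smul_apply,
      smul_eq_mul, Fin.zero_eta, Fin.mk_one]
  · linear_combination (M 0 0 * v 0 + M 0 1 * v 1) * htr - v 0 * hdet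
  · linear_combination (M 1 0 * v 0 + M 1 1 * v 1) * htr - v 1 * hdet

theorem trace_mul_eq_iff {M N : Matrix (Fin 2) (Fin 2) ℝ} {l m : ℝ} (htr : M.trace = l + m)
    (hdet : M.det = l * m) (hlm : l ≠ m) {v : Fin 2 → ℝ} (hv : v ≠ 0) (hMv : M *ᵥ v = l • v) :
    (M * N).trace = m * N.trace ↔ M *ᵥ (N *ᵥ v) = m • (N *ᵥ v) := by
  set Q := M - m • (1 : Matrix (Fin 2) (Fin 2) ℝ) with hQ
  have hQdet : Q.det = 0 := by
    rw [Matrix.trace_fin_two] at htr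
    rw [Matrix.det_fin_two] at hdet ⊢
    simp [hQ]
    linear_combination hdet - m * htr
  have hQv : ∀ w, Q *ᵥ w = M *ᵥ w - m • w := fun w => by
    simp [hQ, Matrix.sub_mulVec, Matrix.smul_mulVec]
  have hQv' : Q *ᵥ v = (l - m) • v := by rw [hQv, hMv, sub_smul]
  have key : (Q * N).trace • ((l - m) • v) = (l - m) • (Q *ᵥ (N *ᵥ v)) := by
    have := congrArg (· *ᵥ v) (mul_mul_eq_trace_smul (N := N) hQdet)
    simp only [← Matrix.mulVec_mulVec, Matrix.smul_mulVec, hQv', Matrix.mulVec_smul] at this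
    exact this.symm
  have hlm' : l - m ≠ 0 := sub_ne_zero.2 hlm
  have h1 : (Q * N).trace = (M * N).trace - m * N.trace := by
    simp [hQ, Matrix.sub_mul]
  rw [← sub_eq_zero, ← h1, ← sub_eq_zero (a := M *ᵥ (N *ᵥ v)), ← hQv]
  constructor
  · intro h
    rw [h, zero_smul] at key
    exact (smul_eq_zero.1 key.symm).resolve_left hlm'
  · intro h
    rw [h, smul_zero] at key
    exact (smul_eq_zero.1 key).resolve_right (smul_ne_zero hlm' hv)

/-! ### The eigenvalue criterion -/

section Criterion

variable {a : ℝ} {q_per q_def q : ℝ → ℝ} {E : ℝ} {W N : ℝ → Matrix (Fin 2) (Fin 2) ℝ} {l m : ℝ}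

theorem isPotential_glued (hp : IsPotential q_per) (hd : IsPotential q_def)
    (hq : ∀ x, q x = if x ≤ 0 then q_per x else if x < 1 then q_def x else q_per (x - 1)) :
    IsPotential q := by
  rw [funext hq]
  exact hp.ite_le (hd.ite_lt (hp.comp_sub 1) 1) 0

theorem IsDefectEigenvalue.exists_solvesOn (hqp : IsPotential q) (h : IsDefectEigenvalue q E) :
    ∃ u v, SolvesOn (fun x => q x - E) u v univ ∧ u ≠ 0 ∧ Integrable fun x => u x ^ 2 := by
  obtain ⟨u, hdu, hu0, hi, hint⟩ := h
  have hv : Continuous (deriv u) := by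
    rw [funext hint]
    exact continuous_const.add (intervalIntegral.continuous_primitive
      (fun x y => (hqp.sub_const E).intervalIntegrable_mul hdu.continuous x y) 0)
  refine ⟨u, deriv u, solvesOn_of_integral (hqp.sub_const E) hdu.continuous hv (fun x => ?_) hint,
    hu0, hi⟩
  rw [intervalIntegral.integral_deriv_eq_sub (fun y _ => hdu y) (hv.intervalIntegrable _ _)]
  ring

theorem SolvesOn.isDefectEigenvalue {u v : ℝ → ℝ} (hqp : IsPotential q)
    (h : SolvesOn (fun x => q x - E) u v univ) (hu : u ≠ 0) (hi : Integrable fun x => u x ^ 2) :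
    IsDefectEigenvalue q E := by
  have h1 : ∀ x, HasDerivAt u (v x) x := by
    intro x
    have : u = fun x => u 0 + ∫ s in (0:ℝ)..x, v s := by
      ext x
      rw [(h.mono (subset_univ _)).integral_fst]
      ring
    rw [this]
    exact (h.2.1.integral_hasStrictDerivAt 0 x).hasDerivAt.const_add _
  have h2 : deriv u = v := funext fun x => (h1 x).deriv
  refine ⟨u, fun x => (h1 x).differentiableAt, hu, hi, fun x => ?_⟩
  rw [h2, (h.mono (subset_univ _)).integral_snd (hqp.sub_const E)]
  ring

theorem IntegrableOn.sq_sub_const_mul {f g : ℝ → ℝ} {s : Set ℝ} (hf : Continuous f)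
    (hg : Continuous g) (hfi : IntegrableOn (fun x => f x ^ 2) s)
    (hgi : IntegrableOn (fun x => g x ^ 2) s) (c : ℝ) :
    IntegrableOn (fun x => (f x - c * g x) ^ 2) s := by
  refine ((hfi.const_mul 2).add (hgi.const_mul (2 * c ^ 2))).mono' (by fun_prop)
    (ae_of_all _ fun x => ?_)
  rw [Real.norm_eq_abs, abs_of_nonneg (sq_nonneg _), Pi.add_apply]
  nlinarith [sq_nonneg (f x + c * g x)]

theorem IsFundamentalSolution.mulVec_eq_smul_of_integrableOn_Iic (ha : 0 < a)
    (hp : IsPotential q_per) (hper : ∀ x, q_per (x + a) = q_per x)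
    (hW : IsFundamentalSolution q_per E W) (htr : (W a).trace = l + m) (hdet : (W a).det = l * m)
    (hm : m ^ 2 < 1) {w : Fin 2 → ℝ}
    (hi : IntegrableOn (fun x => (W x *ᵥ w) 0 ^ 2) (Iic 0)) : W a *ᵥ w = l • w := by
  have hc : ∀ y, Continuous fun x => (W x *ᵥ y) 0 := fun y => (hW.solvesOn_mulVec hp y).1
  rw [← sub_eq_zero]
  refine hW.eq_zero_of_mulVec hp (isOpen_Iio (a := -a)) nonempty_Iio fun x hx => ?_
  refine eq_zero_of_integrableOn_Iic (h := fun x => (W x *ᵥ (W a *ᵥ w - l • w)) 0) (μ := m)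
    ha (hc _) (fun x => ?_) hm ?_ (mem_Iio.1 hx)
  · rw [hW.mulVec_add_period hp hper (sub_smul_mulVec htr hdet w)]
    simp
  · have e : ∀ x, (W x *ᵥ (W a *ᵥ w - l • w)) 0 = (W (x + a) *ᵥ w) 0 - l * (W x *ᵥ w) 0 := by
      intro x
      rw [hW.add_period hp hper, ← Matrix.mulVec_mulVec, Matrix.mulVec_sub, Matrix.mulVec_smul]
      simp
    simp only [e]
    have h1 := integrableOn_comp_add_Iic hi a
    rw [zero_sub] at h1
    exact IntegrableOn.sq_sub_const_mul ((hc w).comp (continuous_add_const a)) (hc w) h1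
      (hi.mono_set (Iic_subset_Iic.2 (by linarith))) l

theorem IsFundamentalSolution.mulVec_eq_smul_of_integrableOn_Ici (ha : 0 < a)
    (hp : IsPotential q_per) (hper : ∀ x, q_per (x + a) = q_per x)
    (hW : IsFundamentalSolution q_per E W) (htr : (W a).trace = l + m) (hdet : (W a).det = l * m)
    (hl : 1 < l ^ 2) {w : Fin 2 → ℝ}
    (hi : IntegrableOn (fun x => (W x *ᵥ w) 0 ^ 2) (Ici 0)) : W a *ᵥ w = m • w := by
  have hc : ∀ y, Continuous fun x => (W x *ᵥ y) 0 := fun y => (hW.solvesOn_mulVec hp y).1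
  rw [← sub_eq_zero]
  refine hW.eq_zero_of_mulVec hp (isOpen_Ioi (a := 0)) nonempty_Ioi fun x hx => ?_
  refine eq_zero_of_integrableOn_Ici (h := fun x => (W x *ᵥ (W a *ᵥ w - m • w)) 0) (μ := l)
    ha (hc _) (fun x => ?_) hl ?_ (mem_Ioi.1 hx)
  · rw [hW.mulVec_add_period hp hper
      (sub_smul_mulVec (htr.trans (add_comm _ _)) (hdet.trans (mul_comm _ _)) w)]
    simp
  · have e : ∀ x, (W x *ᵥ (W a *ᵥ w - m • w)) 0 = (W (x + a) *ᵥ w) 0 - m * (W x *ᵥ w) 0 := by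
      intro x
      rw [hW.add_period hp hper, ← Matrix.mulVec_mulVec, Matrix.mulVec_sub, Matrix.mulVec_smul]
      simp
    simp only [e]
    have h1 := integrableOn_comp_add_Ici hi a
    exact IntegrableOn.sq_sub_const_mul ((hc w).comp (continuous_add_const a)) (hc w)
      (h1.mono_set (Ici_subset_Ici.2 (by linarith))) hi m

/-- A defect eigenvalue in a gap is an energy at which the transfer matrix of the defect maps the
expanding direction of the monodromy matrix to the contracting one. -/
theorem isDefectEigenvalue_iff (ha : 0 < a) (hp : IsPotential q_per) (hd : IsPotential q_def)
    (hper : ∀ x, q_per (x + a) = q_per x)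
    (hq : ∀ x, q x = if x ≤ 0 then q_per x else if x < 1 then q_def x else q_per (x - 1))
    (hW : IsFundamentalSolution q_per E W) (hN : IsFundamentalSolution q_def E N)
    (htr : l + m = (W a).trace) (hlm : l * m = 1) (hl : 1 < l ^ 2) :
    IsDefectEigenvalue q E ↔ (W a * N 1).trace = m * (N 1).trace := by
  have hqp := isPotential_glued hp hd hq
  have hdet : (W a).det = l * m := by
    rw [Matrix.det_fin_two, hlm]
    linarith [hW.det_eq hp a]
  have hm : m ^ 2 < 1 := by
    have : l ^ 2 * m ^ 2 = 1 := by rw [← mul_pow, hlm, one_pow]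
    by_contra! h
    nlinarith
  have hm0 : m ≠ 0 := right_ne_zero_of_mul_eq_one hlm
  have hne : l ≠ m := by
    rintro rfl
    linarith
  constructor
  · intro h
    obtain ⟨u, v, hs, hu0, hi⟩ := h.exists_solvesOn hqp
    have hleft : ∀ x ≤ 0, u x = (W x *ᵥ ![u 0, v 0]) 0 := by
      intro x hx
      rw [← hW.eq_mulVec hp ((hs.mono (subset_univ _)).congr fun s hs => ?_)]
      · rfl
      · rw [min_eq_right hx, max_eq_left hx] at hs
        rw [hq, if_pos hs.2.le]
    have hmid : ∀ x ∈ Icc (0 : ℝ) 1, ![u x, v x] = N x *ᵥ ![u 0, v 0] := by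
      intro x hx
      refine hN.eq_mulVec hd ((hs.mono (subset_univ _)).congr fun s hs => ?_)
      rw [min_eq_left hx.1, max_eq_right hx.1] at hs
      rw [hq, if_neg (not_le.2 hs.1), if_pos (hs.2.trans_le hx.2)]
    have hright : ∀ x, 0 ≤ x → u (x + 1) = (W x *ᵥ ![u 1, v 1]) 0 := by
      intro x hx
      have h1 := hW.eq_mulVec hp (x := x) (((hs.comp_add 1).mono (subset_univ _)).congr
        fun s hs => ?_)
      · simp only [zero_add] at h1
        rw [← h1]
        rfl
      · rw [min_eq_left hx, max_eq_right hx] at hs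
        have h0 := hs.1
        rw [hq, if_neg (by linarith), if_neg (by linarith), add_sub_cancel_right]
    have h01 := hmid 1 (by simp)
    set w : Fin 2 → ℝ := ![u 0, v 0] with hw
    have hw0 : w ≠ 0 := by
      intro h0
      rw [h0] at hleft hmid h01
      rw [h01] at hright
      refine hu0 (funext fun x => ?_)
      rcases le_total x 0 with hx | hx
      · simpa using hleft x hx
      rcases le_total x 1 with hx1 | hx1
      · simpa using congrFun (hmid x ⟨hx, hx1⟩) 0
      · simpa using hright (x - 1) (by linarith)
    have hMl : W a *ᵥ w = l • w := by
      refine hW.mulVec_eq_smul_of_integrableOn_Iic ha hp hper htr.symm hdet hm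
        (hi.integrableOn.congr_fun (fun x hx => ?_) measurableSet_Iic)
      simp only [hleft x hx]
    have hMm : W a *ᵥ (N 1 *ᵥ w) = m • (N 1 *ᵥ w) := by
      rw [← h01]
      have h1 := integrableOn_comp_add_Ici (hi.integrableOn (s := Ici 1)) 1
      rw [sub_self] at h1
      refine hW.mulVec_eq_smul_of_integrableOn_Ici ha hp hper htr.symm hdet hl
        (h1.congr_fun (fun x hx => ?_) measurableSet_Ici)
      simp only [hright x hx]
    exact (trace_mul_eq_iff htr.symm hdet hne hw0 hMl).2 hMm
  · intro h
    obtain ⟨w, hw0, hMl⟩ := exists_eigenvector htr.symm hdet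
    have hMm := (trace_mul_eq_iff htr.symm hdet hne hw0 hMl).1 h
    set z := N 1 *ᵥ w with hz
    have s0 := hW.solvesOn_mulVec hp w
    have s1 := hN.solvesOn_mulVec hd w
    have s2 := ((hW.solvesOn_mulVec hp z).comp_add (-1))
    have g1 := SolvesOn.ite (p := fun x => q x - E) (I := Ioi 0) (b := 1)
      ((s1.mono (subset_univ _)).congr fun s hs => by
        rw [hq, if_neg (not_le.2 hs.1), if_pos (mem_Iio.1 hs.2)])
      ((s2.mono (subset_univ _)).congr fun s hs => by
        rw [hq, if_neg (not_le.2 hs.1), if_neg (not_lt.2 (le_of_lt hs.2)), sub_eq_add_neg s 1])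
      (by simp [hW.zero, hz]) (by simp [hW.zero, hz])
    have g0 := SolvesOn.ite (p := fun x => q x - E) (I := univ) (b := 0)
      ((s0.mono (subset_univ _)).congr fun s hs => by
        rw [hq, if_pos (le_of_lt hs.2)])
      (g1.mono fun s hs => hs.2) (by simp [hW.zero, hN.zero]) (by simp [hW.zero, hN.zero])
    refine g0.isDefectEigenvalue hqp (fun h0 => hw0 ?_) ?_
    · refine hW.eq_zero_of_mulVec hp (isOpen_Iio (a := 0)) nonempty_Iio fun x hx => ?_
      have := congrFun h0 x
      rwa [if_pos (le_of_lt hx)] at this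
    · have i0 : IntegrableOn (fun x => (W x *ᵥ w) 0 ^ 2) (Iic 0) :=
        integrableOn_Iic_of_quasiPeriodic ha s0.1 (fun x => by
          rw [hW.mulVec_add_period hp hper hMl]; simp) hl 0
      have i1 : IntegrableOn (fun x => (N x *ᵥ w) 0 ^ 2) (Ioc 0 1) :=
        ((s1.1.pow 2).integrableOn_Icc).mono_set Ioc_subset_Icc_self
      have i2 : IntegrableOn (fun x => (W (x + -1) *ᵥ z) 0 ^ 2) (Ioi 1) := by
        have h1 := integrableOn_comp_add_Ici (integrableOn_Ici_of_quasiPeriodic ha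
          (hW.solvesOn_mulVec hp z).1 (fun x => by
            rw [hW.mulVec_add_period hp hper hMm]; simp) hm0 hm 0) (-1)
        exact h1.mono_set fun x hx => by
          have : 1 < x := hx
          simp [this.le]
      rw [← integrableOn_univ, ← Iic_union_Ioi (a := (0:ℝ)),
        ← Ioc_union_Ioi_eq_Ioi (zero_le_one' ℝ)]
      refine (i0.congr_fun (fun x hx => ?_) measurableSet_Iic).union
        ((i1.congr_fun (fun x hx => ?_) measurableSet_Ioc).union
        (i2.congr_fun (fun x hx => ?_) measurableSet_Ioi))
      · simp only [if_pos (mem_Iic.1 hx)]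
      · simp only [if_neg (not_le.2 hx.1), if_pos hx.2]
      · have hx1 : 1 < x := hx
        simp only [if_neg (not_le.2 hx1), if_neg (not_le.2 (zero_lt_one.trans hx1))]

end Criterion

/-! ### Low energies -/

section LowEnergy

variable {p : ℝ → ℝ} {E L : ℝ} {W : ℝ → Matrix (Fin 2) (Fin 2) ℝ}

theorem IsFundamentalSolution.form_pos (hp : IsPotential p) (hW : IsFundamentalSolution p E W)
    (hE : ∀ x, 1 ≤ p x - E) (hL : 0 < L) {y : Fin 2 → ℝ} (hy : y ≠ 0) :
    y 0 * y 1 < (W L *ᵥ y) 0 * (W L *ᵥ y) 1 := by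
  obtain ⟨hu, hv, S, hS, hd⟩ := hW.solvesOn_mulVec hp y
  set u := fun x => (W x *ᵥ y) 0 with hu'
  set v := fun x => (W x *ᵥ y) 1 with hv'
  have hne : ∀ x, u x ≠ 0 ∨ v x ≠ 0 := by
    intro x
    by_contra! h
    refine hy ?_
    have hdet := hW.det_eq hp x
    obtain ⟨h0, h1⟩ := h
    simp only [hu', hv', Matrix.mulVec, dotProduct, Fin.sum_univ_two] at h0 h1
    ext i
    fin_cases i
    · simp only [Fin.zero_eta, Pi.zero_apply]
      linear_combination -y 0 * hdet + W x 1 1 * h0 - W x 0 1 * h1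
    · simp only [Fin.mk_one, Pi.zero_apply]
      linear_combination -y 1 * hdet - W x 1 0 * h0 + W x 0 0 * h1
  have hint : IntervalIntegrable (fun x => v x * v x + (p x - E) * (u x * u x)) volume 0 L :=
    ((hv.mul hv).intervalIntegrable _ _).add
      ((hp.sub_const E).intervalIntegrable_mul (hu.mul hu) _ _)
  have h1 := integral_eq_of_hasDerivAt_off_countable (fun x => u x * v x) _ (a := 0) (b := L) hS
    (by fun_prop) (fun x hx => ((hd x ⟨mem_univ _, hx.2⟩).1.mul
      (hd x ⟨mem_univ _, hx.2⟩).2).congr_deriv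
      (show _ = v x * v x + (p x - E) * (u x * u x) by simp only [hu', hv']; ring)) hint
  have h2 : 0 < ∫ x in (0:ℝ)..L, v x * v x + (p x - E) * (u x * u x) := by
    refine intervalIntegral.intervalIntegral_pos_of_pos_on hint (fun x _ => ?_) hL
    have := hE x
    rcases hne x with h | h
    · have := mul_self_pos.2 h
      nlinarith [mul_self_nonneg (v x)]
    · have := mul_self_pos.2 h
      nlinarith [mul_self_nonneg (u x)]
  rw [h1] at h2
  simp only [hu', hv', hW.zero, Matrix.one_mulVec] at h2
  linarith

theorem IsFundamentalSolution.four_lt_sq_trace (hp : IsPotential p)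
    (hW : IsFundamentalSolution p E W) (hE : ∀ x, 1 ≤ p x - E) (hL : 0 < L) :
    4 < (W L).trace ^ 2 := by
  have hdet := hW.det_eq hp L
  have h := fun (x y : ℝ) (hxy : ![x, y] ≠ 0) => hW.form_pos hp hE hL hxy
  simp only [Matrix.mulVec, dotProduct, Fin.sum_univ_two, Matrix.cons_val_zero,
    Matrix.cons_val_one] at h
  rw [Matrix.trace_fin_two]
  set A := W L 0 0 * W L 1 0 with hA
  set P := W L 0 0 * W L 1 1 with hP
  have hA0 : 0 < A := by
    have := h 1 0 (fun h => by simpa using congrFun h 0)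
    linarith
  have h1 := h (-(P - 1)) A (fun h => hA0.ne' (by simpa using congrFun h 1))
  have h2 : 0 < A * (P - 1) := by
    have e : W L 1 0 * W L 0 1 = P - 1 := by linarith
    have : (W L 0 0 * -(P - 1) + W L 0 1 * A) * (W L 1 0 * -(P - 1) + W L 1 1 * A) -
        -(P - 1) * A = A * (P - 1) := by
      linear_combination -((P - 1) ^ 2 - W L 0 1 * W L 1 1 * A) * hA +
        ((P - 1) * A - A * (W L 1 0 * W L 0 1)) * hP + (A * P - (P - 1) * A) * e
    linarith
  have h3 : 0 < P - 1 := pos_of_mul_pos_right h2 hA0.le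
  nlinarith [sq_nonneg (W L 0 0 - W L 1 1)]

theorem exists_four_lt_sq_trace {W : ℝ → ℝ → Matrix (Fin 2) (Fin 2) ℝ} (hp : IsPotential p)
    (hW : ∀ E, IsFundamentalSolution p E (W E)) (hL : 0 < L) :
    ∃ R, ∀ E ≤ R, 4 < (W E L).trace ^ 2 := by
  obtain ⟨C, hC⟩ := hp.1
  refine ⟨-C - 1, fun E hE => (hW E).four_lt_sq_trace hp (fun x => ?_) hL⟩
  linarith [neg_abs_le (p x), hC x]

end LowEnergy

theorem IsGap.subset_Ioi {k : ℝ → ℝ} {G : Set ℝ} {R : ℝ} (h : IsGap k G)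
    (hR : ∀ E ≤ R, 4 < k E ^ 2) : G ⊆ Ioi R := by
  intro E hE
  by_contra! hER
  have h1 : Iic R ⊆ G := by
    rw [h.eq_component hE]
    exact isPreconnected_Iic.subset_connectedComponentIn (show E ≤ R from not_lt.1 hER) hR
  exact not_bddBelow_Iic R (h.1.bddBelow.mono h1)

/-! ### High energies -/

section HighEnergy

theorem isFundamentalSolution_const (c : ℝ) {w : ℝ} (hw : w ≠ 0) :
    IsFundamentalSolution (fun _ => c) (c + w ^ 2) fun x =>
      !![Real.cos (w * x), Real.sin (w * x) / w; -w * Real.sin (w * x), Real.cos (w * x)] := by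
  have hmul : ∀ x, HasDerivAt (fun x => w * x) w x := fun x => by
    simpa using (hasDerivAt_id x).const_mul w
  have hc : ∀ x, HasDerivAt (fun x => Real.cos (w * x)) (-w * Real.sin (w * x)) x := fun x =>
    (hmul x).cos.congr_deriv (by ring)
  have hs : ∀ x, HasDerivAt (fun x => Real.sin (w * x)) (Real.cos (w * x) * w) x := fun x =>
    (hmul x).sin
  refine ⟨fun i j => by fin_cases i <;> fin_cases j <;> simp <;> fun_prop, fun x i j => ?_⟩
  have key : ∀ f f' : ℝ → ℝ, (∀ x, HasDerivAt f (f' x) x) → Continuous f' →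
      f x = f 0 + ∫ s in (0:ℝ)..x, f' s := fun f f' hf hf' => by
    rw [intervalIntegral.integral_eq_sub_of_hasDerivAt (fun s _ => hf s)
      (hf'.intervalIntegrable _ _)]
    ring
  fin_cases i <;> fin_cases j
  · simp [Matrix.mul_apply, Fin.sum_univ_two]
  · simpa [Matrix.mul_apply, Fin.sum_univ_two] using
      key (fun x => Real.sin (w * x) / w) (fun x => Real.cos (w * x))
        (fun x => ((hs x).div_const w).congr_deriv (by field_simp)) (by fun_prop)
  · have := key (fun x => -w * Real.sin (w * x)) (fun x => -w ^ 2 * Real.cos (w * x))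
        (fun x => ((hs x).const_mul (-w)).congr_deriv (by ring)) (by fun_prop)
    simpa [Matrix.mul_apply, Fin.sum_univ_two] using this
  · have := key (fun x => Real.cos (w * x)) (fun x => -w ^ 2 * (Real.sin (w * x) / w))
        (fun x => (hc x).congr_deriv (by field_simp)) (by fun_prop)
    simpa [Matrix.mul_apply, Fin.sum_univ_two] using this

/-- The Riemann–Lebesgue lemma on a bounded interval. -/
theorem tendsto_integral_mul_cos_sin {g : ℝ → ℝ} (hg : IsPotential g) {L : ℝ} (hL : 0 ≤ L) :
    Tendsto (fun w => ∫ s in (0:ℝ)..L, g s * Real.cos (w * s)) atTop (𝓝 0) ∧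
      Tendsto (fun w => ∫ s in (0:ℝ)..L, g s * Real.sin (w * s)) atTop (𝓝 0) := by
  set f : ℝ → ℂ := (Ioc 0 L).indicator fun s => (g s : ℂ) with hf
  have h0 := (Real.tendsto_integral_exp_smul_cocompact f).comp
    ((tendsto_id.atTop_div_const (show 0 < 2 * Real.pi by positivity)).mono_right
      atTop_le_cocompact)
  have hgi : IntervalIntegrable g volume 0 L := hg.intervalIntegrable 0 L
  have key : ∀ w : ℝ, (∫ v, Real.fourierChar (-(v * (w / (2 * Real.pi)))) • f v) =
      ((∫ s in (0:ℝ)..L, g s * Real.cos (w * s) : ℝ) : ℂ) -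
        ((∫ s in (0:ℝ)..L, g s * Real.sin (w * s) : ℝ) : ℂ) * Complex.I := by
    intro w
    have e : ∀ v, Real.fourierChar (-(v * (w / (2 * Real.pi)))) • f v =
        (Ioc 0 L).indicator (fun s => ((g s * Real.cos (w * s) : ℝ) : ℂ) -
          ((g s * Real.sin (w * s) : ℝ) : ℂ) * Complex.I) v := by
      intro v
      by_cases hv : v ∈ Ioc 0 L
      · simp only [hf, indicator_of_mem hv, Circle.smul_def, Real.fourierChar_apply, smul_eq_mul]
        have : ((2 * Real.pi * -(v * (w / (2 * Real.pi))) : ℝ) : ℂ) * Complex.I =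
            ((-(w * v) : ℝ) : ℂ) * Complex.I := by
          congr 2
          field_simp
        rw [this, Complex.exp_mul_I]
        push_cast
        rw [Complex.cos_neg, Complex.sin_neg]
        ring
      · simp [hf, indicator_of_notMem hv]
    simp only [e]
    rw [integral_indicator measurableSet_Ioc, ← intervalIntegral.integral_of_le hL,
      intervalIntegral.integral_sub, intervalIntegral.integral_mul_const,
      intervalIntegral.integral_ofReal, intervalIntegral.integral_ofReal]
    · have := hg.intervalIntegrable_mul (f := fun s => Real.cos (w * s)) (by fun_prop) 0 L
      exact ⟨Integrable.ofReal this.1, Integrable.ofReal this.2⟩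
    · have := hg.intervalIntegrable_mul (f := fun s => Real.sin (w * s)) (by fun_prop) 0 L
      exact IntervalIntegrable.mul_const ⟨Integrable.ofReal this.1, Integrable.ofReal this.2⟩ _
  simp only [Function.comp_def, id, key] at h0
  refine ⟨?_, ?_⟩
  · have := (Complex.continuous_re.tendsto _).comp h0
    simpa [Function.comp_def, -Complex.ofReal_cos, -Complex.ofReal_sin] using this
  · have := ((Complex.continuous_im.tendsto _).comp h0).neg
    simpa [Function.comp_def] using this

/-- First-order averages of a mean-zero potential against products of trigonometric functions. -/
theorem tendsto_integral_mul_trig {g : ℝ → ℝ} (hg : IsPotential g) {L : ℝ} (hL : 0 ≤ L)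
    (h0 : ∫ s in (0:ℝ)..L, g s = 0) :
    Tendsto (fun w => ∫ s in (0:ℝ)..L, g s * (Real.cos (w * s) * Real.cos (w * s))) atTop (𝓝 0) ∧
      Tendsto (fun w => ∫ s in (0:ℝ)..L, g s * (Real.sin (w * s) * Real.cos (w * s)))
        atTop (𝓝 0) ∧
      Tendsto (fun w => ∫ s in (0:ℝ)..L, g s * (Real.sin (w * s) * Real.sin (w * s)))
        atTop (𝓝 0) := by
  obtain ⟨hc, hs⟩ := tendsto_integral_mul_cos_sin hg hL
  have h2 : Tendsto (fun w : ℝ => 2 * w) atTop atTop := tendsto_id.const_mul_atTop two_pos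
  have hc2 := (hc.comp h2).div_const 2
  have hs2 := (hs.comp h2).div_const 2
  rw [zero_div] at hc2 hs2
  have hgi := hg.intervalIntegrable 0 L
  have hgc : ∀ w, IntervalIntegrable (fun s => g s * Real.cos (2 * w * s)) volume 0 L := fun w =>
    hg.intervalIntegrable_mul (f := fun s => Real.cos (2 * w * s)) (by fun_prop) 0 L
  refine ⟨hc2.congr fun w => ?_, hs2.congr fun w => ?_, ?_⟩
  · have e : ∀ s, g s * (Real.cos (w * s) * Real.cos (w * s)) =
        (g s + g s * Real.cos (2 * w * s)) / 2 := fun s => by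
      rw [mul_assoc 2, Real.cos_two_mul]
      ring
    simp only [e, Function.comp_def]
    rw [intervalIntegral.integral_div, intervalIntegral.integral_add hgi (hgc w), h0, zero_add]
  · have e : ∀ s, g s * (Real.sin (w * s) * Real.cos (w * s)) =
        (g s * Real.sin (2 * w * s)) / 2 := fun s => by
      rw [mul_assoc 2, Real.sin_two_mul]
      ring
    simp only [e, Function.comp_def]
    rw [intervalIntegral.integral_div]
  · have h3 := hc2.neg
    rw [neg_zero] at h3
    refine h3.congr fun w => ?_
    have e : ∀ s, g s * (Real.sin (w * s) * Real.sin (w * s)) =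
        (g s - g s * Real.cos (2 * w * s)) / 2 := fun s => by
      rw [mul_assoc 2, Real.cos_two_mul]
      linear_combination g s * Real.sin_sq_add_cos_sq (w * s)
    simp only [e, Function.comp_def]
    rw [intervalIntegral.integral_div, intervalIntegral.integral_sub hgi (hgc w), h0, zero_sub]
    ring

end HighEnergy

/-! ### Asymptotics of the bands -/

section Asymptotics

theorem abs_sub_le_of_duhamel {g ψ τ : ℝ → ℝ} {K L w : ℝ} (hL : 0 < L) (hw : 0 < w)
    (hKw : 4 * K * L ≤ w) (hg : ∀ x, |g x| ≤ K) (hψ : Continuous ψ) (hτ : ∀ x, |τ x| ≤ 1)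
    (h : ∀ x, ψ x = τ x + (Real.sin (w * x) * (∫ s in (0:ℝ)..x, g s * (Real.cos (w * s) * ψ s)) -
      Real.cos (w * x) * ∫ s in (0:ℝ)..x, g s * (Real.sin (w * s) * ψ s)) / w) :
    ∀ x ∈ Icc 0 L, |ψ x - τ x| ≤ 4 * K * L / w := by
  have hK : 0 ≤ K := (abs_nonneg _).trans (hg 0)
  obtain ⟨z, hz, hmax⟩ := isCompact_Icc.exists_isMaxOn (nonempty_Icc.2 hL.le) hψ.abs.continuousOn
  set B := |ψ z| with hB
  have hB0 : 0 ≤ B := abs_nonneg _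
  have hBx : ∀ x ∈ Icc 0 L, |ψ x| ≤ B := fun x hx => hmax hx
  have step : ∀ x ∈ Icc 0 L, |ψ x - τ x| ≤ 2 * K * L * B / w := by
    intro x hx
    have hint : ∀ f : ℝ → ℝ, (∀ s, |f s| ≤ 1) →
        |∫ s in (0:ℝ)..x, g s * (f s * ψ s)| ≤ K * (1 * B) * L := fun f hf =>
      abs_integral_le_of_bound hx.1 hx.2 (by positivity) fun s hs => by
        rw [abs_mul, abs_mul]
        exact mul_le_mul (hg s) (mul_le_mul (hf s) (hBx s hs) (abs_nonneg _) zero_le_one)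
          (by positivity) hK
    rw [h x, add_sub_cancel_left, abs_div, abs_of_pos hw]
    refine div_le_div_of_nonneg_right ((abs_sub _ _).trans ?_) hw.le
    rw [abs_mul, abs_mul]
    have h1 := mul_le_mul (Real.abs_sin_le_one (w * x))
      (hint (fun s => Real.cos (w * s)) fun s => Real.abs_cos_le_one _) (abs_nonneg _) zero_le_one
    have h2 := mul_le_mul (Real.abs_cos_le_one (w * x))
      (hint (fun s => Real.sin (w * s)) fun s => Real.abs_sin_le_one _) (abs_nonneg _) zero_le_one
    linarith
  have hB2 : B ≤ 2 := by
    have h1 : 2 * K * L * B / w ≤ B / 2 := by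
      rw [div_le_div_iff₀ hw two_pos]
      nlinarith
    linarith [step z hz, abs_sub_abs_le_abs_sub (ψ z) (τ z), hτ z]
  intro x hx
  refine (step x hx).trans (div_le_div_of_nonneg_right ?_ hw.le)
  have : 0 ≤ 2 * K * L := by positivity
  nlinarith

theorem tendsto_integral_of_abs_sub_le {g : ℝ → ℝ} (hg : IsPotential g) {L B : ℝ} (hL : 0 < L)
    {σ τ ψ : ℝ → ℝ → ℝ} (hσ : ∀ w s, |σ w s| ≤ 1) (hσc : ∀ w, Continuous (σ w))
    (hτc : ∀ w, Continuous (τ w)) (hψc : ∀ w, Continuous (ψ w))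
    (hψ : ∀ᶠ w in atTop, ∀ x ∈ Icc 0 L, |ψ w x - τ w x| ≤ B / w)
    (h : Tendsto (fun w => ∫ s in (0:ℝ)..L, g s * (σ w s * τ w s)) atTop (𝓝 0)) :
    Tendsto (fun w => ∫ s in (0:ℝ)..L, g s * (σ w s * ψ w s)) atTop (𝓝 0) := by
  obtain ⟨K, hK⟩ := hg.1
  have hK0 : 0 ≤ K := (abs_nonneg _).trans (hK 0)
  have h1 : Tendsto (fun w => (∫ s in (0:ℝ)..L, g s * (σ w s * ψ w s)) -
      ∫ s in (0:ℝ)..L, g s * (σ w s * τ w s)) atTop (𝓝 0) := by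
    rw [tendsto_zero_iff_norm_tendsto_zero]
    have hlim : Tendsto (fun w : ℝ => K * (1 * (B / w)) * L) atTop (𝓝 0) := by
      have := ((tendsto_const_nhds (x := B)).div_atTop (tendsto_id (α := ℝ))).const_mul (K * L)
      rw [mul_zero] at this
      exact this.congr fun w => by simp only [id]; ring
    refine squeeze_zero' (Eventually.of_forall fun _ => norm_nonneg _) ?_ hlim
    filter_upwards [hψ] with w hw
    rw [← intervalIntegral.integral_sub
      (hg.intervalIntegrable_mul (f := fun s => σ w s * ψ w s) ((hσc w).mul (hψc w)) _ _)
      (hg.intervalIntegrable_mul (f := fun s => σ w s * τ w s) ((hσc w).mul (hτc w)) _ _),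
      Real.norm_eq_abs]
    have hBw : 0 ≤ B / w := (abs_nonneg _).trans (hw 0 ⟨le_rfl, hL.le⟩)
    refine abs_integral_le_of_bound hL.le le_rfl (by positivity) fun s hs => ?_
    rw [← mul_sub, ← mul_sub, abs_mul, abs_mul]
    exact mul_le_mul (hK s) (mul_le_mul (hσ w s) (hw s hs) (abs_nonneg _) zero_le_one)
      (by positivity) hK0
  simpa using h1.add h

variable {p : ℝ → ℝ} {W : ℝ → Matrix (Fin 2) (Fin 2) ℝ}

theorem IsFundamentalSolution.duhamel {c w : ℝ} (hp : IsPotential p) (hw : w ≠ 0)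
    (hW : IsFundamentalSolution p (c + w ^ 2) W) (x : ℝ) (j : Fin 2) :
    W x 0 j = Real.cos (w * x) * ((1 : Matrix (Fin 2) (Fin 2) ℝ) 0 j -
        (∫ s in (0:ℝ)..x, (p s - c) * (Real.sin (w * s) * W s 0 j)) / w) +
      Real.sin (w * x) / w * ((1 : Matrix (Fin 2) (Fin 2) ℝ) 1 j +
        ∫ s in (0:ℝ)..x, (p s - c) * (Real.cos (w * s) * W s 0 j)) ∧
    W x 1 j = -w * Real.sin (w * x) * ((1 : Matrix (Fin 2) (Fin 2) ℝ) 0 j -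
        (∫ s in (0:ℝ)..x, (p s - c) * (Real.sin (w * s) * W s 0 j)) / w) +
      Real.cos (w * x) * ((1 : Matrix (Fin 2) (Fin 2) ℝ) 1 j +
        ∫ s in (0:ℝ)..x, (p s - c) * (Real.cos (w * s) * W s 0 j)) := by
  have h := (isFundamentalSolution_const c hw).variation (isPotential_const c)
    (hp.sub_const (c + w ^ 2)) ((hW.solvesOn hp j).mono (subset_univ _)) (x := x)
  have e : ∀ s, (p s - (c + w ^ 2) - (c - (c + w ^ 2))) * (Real.sin (w * s) / w * W s 0 j) =
      (p s - c) * (Real.sin (w * s) * W s 0 j) / w := fun s => by ring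
  have e' : ∀ s, p s - (c + w ^ 2) - (c - (c + w ^ 2)) = p s - c := fun s => by ring
  simp only [Matrix.of_apply, Matrix.cons_val', Matrix.cons_val_zero, Matrix.cons_val_one,
    Matrix.cons_val_fin_one, e, intervalIntegral.integral_div] at h
  simp only [e', hW.zero] at h
  exact h

theorem abs_le_of_four_le_sq_trace {S C a₀ a₁ b₀ b₁ ε m₀₀ m₀₁ m₁₀ m₁₁ : ℝ}
    (hε : 0 < ε) (hSC : S ^ 2 + C ^ 2 = 1)
    (ha₀ : |a₀| ≤ ε) (ha₁ : |a₁| ≤ ε) (hb₀ : |b₀| ≤ ε) (hb₁ : |b₁| ≤ ε)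
    (h₀₀ : m₀₀ = C * (1 - a₀) + S * b₀) (h₁₀ : m₁₀ = -S * (1 - a₀) + C * b₀)
    (h₀₁ : m₀₁ = -C * a₁ + S * (1 + b₁)) (h₁₁ : m₁₁ = S * a₁ + C * (1 + b₁))
    (hdet : m₀₀ * m₁₁ - m₁₀ * m₀₁ = 1) (htr : 4 ≤ (m₀₀ + m₁₁) ^ 2) : |S| ≤ 6 * ε := by
  have hS : |S| ≤ 1 := abs_le_one_iff_mul_self_le_one.2 (by nlinarith [sq_nonneg C])
  have hC : |C| ≤ 1 := abs_le_one_iff_mul_self_le_one.2 (by nlinarith [sq_nonneg S])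
  have hmul : ∀ {s t : ℝ}, |s| ≤ 1 → |t| ≤ ε → |s * t| ≤ ε := fun hs ht => by
    rw [abs_mul]
    simpa using mul_le_mul hs ht (abs_nonneg _) zero_le_one
  have p1 := abs_le.1 (hmul hS ha₀)
  have p2 := abs_le.1 (hmul hS ha₁)
  have p3 := abs_le.1 (hmul hS hb₀)
  have p4 := abs_le.1 (hmul hS hb₁)
  have q1 := abs_le.1 (hmul hC ha₀)
  have q2 := abs_le.1 (hmul hC ha₁)
  have q3 := abs_le.1 (hmul hC hb₀)
  have q4 := abs_le.1 (hmul hC hb₁)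
  have hA : |m₁₁ - m₀₀| ≤ 4 * ε := by
    rw [h₀₀, h₁₁]
    exact abs_le.2 ⟨by linarith, by linarith⟩
  have he₁ : |m₀₁ - S| ≤ 2 * ε := by
    rw [h₀₁]
    exact abs_le.2 ⟨by linarith, by linarith⟩
  have he₂ : |m₁₀ + S| ≤ 2 * ε := by
    rw [h₁₀]
    exact abs_le.2 ⟨by linarith, by linarith⟩
  have hA2 : (m₁₁ - m₀₀) ^ 2 ≤ (4 * ε) ^ 2 := sq_le_sq' (abs_le.1 hA).1 (abs_le.1 hA).2
  have he : (m₀₁ - S) * (m₁₀ + S) ≤ 2 * ε * (2 * ε) := by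
    refine (le_abs_self _).trans ?_
    rw [abs_mul]
    exact mul_le_mul he₁ he₂ (abs_nonneg _) (by positivity)
  have hS1 : S * (m₁₀ + S) ≤ |S| * (2 * ε) := by
    refine (le_abs_self _).trans ?_
    rw [abs_mul]
    exact mul_le_mul_of_nonneg_left he₂ (abs_nonneg _)
  have hS2 : -(S * (m₀₁ - S)) ≤ |S| * (2 * ε) := by
    refine (neg_le_abs _).trans ?_
    rw [abs_mul]
    exact mul_le_mul_of_nonneg_left he₁ (abs_nonneg _)
  have key : |S| ^ 2 ≤ 8 * ε ^ 2 + 4 * ε * |S| := by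
    rw [sq_abs]
    nlinarith
  by_contra! hlt
  nlinarith

theorem exists_int_abs_sq_sub_le {w L η : ℝ} (hL : 0 < L) (hw : 0 < w)
    (hsin : |Real.sin (w * L)| ≤ 6 * η / w) (hηw : 3 * Real.pi * η ≤ w ^ 2 * L) :
    ∃ n : ℕ, |w ^ 2 - (Real.pi * n / L) ^ 2| ≤ 9 * Real.pi * η / L := by
  have hpi := Real.pi_pos
  set n := round (w * L / Real.pi) with hn
  have h1 : |w * L - n * Real.pi| ≤ Real.pi / 2 := by
    have := abs_sub_round (w * L / Real.pi)
    have e : w * L - n * Real.pi = (w * L / Real.pi - n) * Real.pi := by field_simp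
    rw [e, abs_mul, abs_of_pos hpi]
    nlinarith
  have h2 : |w * L - n * Real.pi| ≤ 3 * Real.pi * η / w := by
    have h3 := Real.mul_abs_le_abs_sin h1
    rw [Real.sin_sub_int_mul_pi, abs_mul, abs_zpow, abs_neg, abs_one, _root_.one_zpow,
      one_mul] at h3
    have h4 := h3.trans hsin
    have h5 := mul_le_mul_of_nonneg_left h4 (show 0 ≤ Real.pi / 2 by positivity)
    have e1 : Real.pi / 2 * (2 / Real.pi * |w * L - n * Real.pi|) = |w * L - n * Real.pi| := by
      field_simp
    have e2 : Real.pi / 2 * (6 * η / w) = 3 * Real.pi * η / w := by ring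
    linarith
  refine ⟨n.natAbs, ?_⟩
  have hnat : (Real.pi * (n.natAbs : ℝ) / L) ^ 2 = (Real.pi * n / L) ^ 2 := by
    rw [Nat.cast_natAbs, Int.cast_abs, div_pow, mul_pow, sq_abs, ← mul_pow, ← div_pow]
  rw [hnat]
  set d := w - Real.pi * n / L with hd
  have hd1 : |d| ≤ 3 * Real.pi * η / (w * L) := by
    have e : d = (w * L - n * Real.pi) / L := by
      rw [hd]
      field_simp
    rw [e, abs_div, abs_of_pos hL, ← div_div]
    exact div_le_div_of_nonneg_right h2 hL.le
  have hd2 : |d| ≤ w := hd1.trans <| by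
    rw [div_le_iff₀ (by positivity)]
    linarith
  have e : w ^ 2 - (Real.pi * n / L) ^ 2 = d * (2 * w - d) := by
    rw [hd]
    ring
  rw [e, abs_mul]
  have h6 : |2 * w - d| ≤ 3 * w := by
    rw [abs_le] at hd2 ⊢
    constructor <;> linarith
  refine (mul_le_mul hd1 h6 (abs_nonneg _) ((abs_nonneg _).trans hd1)).trans (le_of_eq ?_)
  field_simp
  ring

theorem eventually_exists_abs_sub_sq_le {W : ℝ → ℝ → Matrix (Fin 2) (Fin 2) ℝ}
    (hp : IsPotential p) (hW : ∀ E, IsFundamentalSolution p E (W E)) {L c η : ℝ} (hL : 0 < L)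
    (hc : c = 1 / L * ∫ s in (0:ℝ)..L, p s) (hη : 0 < η) :
    ∀ᶠ E in atTop, 4 ≤ (W E L).trace ^ 2 →
      ∃ n : ℕ, |E - c - (Real.pi * n / L) ^ 2| ≤ η := by
  have hpi := Real.pi_pos
  have hg := hp.sub_const c
  obtain ⟨K, hK⟩ := hg.1
  have hg0 : ∫ s in (0:ℝ)..L, p s - c = 0 := by
    rw [intervalIntegral.integral_sub (hp.intervalIntegrable _ _) (by simp), hc]
    simp
    field_simp
    ring
  obtain ⟨hcc, hsc, hss⟩ := tendsto_integral_mul_trig hg hL.le hg0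
  have hcont : ∀ E i j, Continuous fun x => W E x i j := fun E => (hW E).1
  have hlarge : ∀ᶠ w : ℝ in atTop, 0 < w ∧ 4 * K * L ≤ w :=
    (eventually_gt_atTop 0).and (eventually_ge_atTop _)
  have hψ0 : ∀ᶠ w in atTop, ∀ x ∈ Icc 0 L,
      |W (c + w ^ 2) x 0 0 - Real.cos (w * x)| ≤ 4 * K * L / w := by
    filter_upwards [hlarge] with w hw
    refine abs_sub_le_of_duhamel hL hw.1 hw.2 hK (hcont _ 0 0)
      (fun x => Real.abs_cos_le_one _) fun x => ?_
    rw [((hW (c + w ^ 2)).duhamel hp hw.1.ne' x 0).1]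
    simp
    ring
  have hψ1 : ∀ᶠ w in atTop, ∀ x ∈ Icc 0 L,
      |w * W (c + w ^ 2) x 0 1 - Real.sin (w * x)| ≤ 4 * K * L / w := by
    filter_upwards [hlarge] with w hw
    refine abs_sub_le_of_duhamel hL hw.1 hw.2 hK ((hcont _ 0 1).const_mul w)
      (fun x => Real.abs_sin_le_one _) fun x => ?_
    have e : ∀ f : ℝ → ℝ, (∫ s in (0:ℝ)..x, (p s - c) * (f s * (w * W (c + w ^ 2) s 0 1))) =
        w * ∫ s in (0:ℝ)..x, (p s - c) * (f s * W (c + w ^ 2) s 0 1) := fun f => by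
      rw [← intervalIntegral.integral_const_mul]
      congr 1
      ext s
      ring
    rw [e fun s => Real.cos (w * s), e fun s => Real.sin (w * s),
      ((hW (c + w ^ 2)).duhamel hp hw.1.ne' x 1).1]
    have := hw.1.ne'
    simp
    field_simp
    ring
  have hcw : ∀ w : ℝ, Continuous fun s => Real.cos (w * s) := fun w => by fun_prop
  have hsw : ∀ w : ℝ, Continuous fun s => Real.sin (w * s) := fun w => by fun_prop
  have hcs : Tendsto (fun w => ∫ s in (0:ℝ)..L, (p s - c) *
      (Real.cos (w * s) * Real.sin (w * s))) atTop (𝓝 0) := by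
    simpa only [mul_comm (Real.sin _)] using hsc
  have hα0 := tendsto_integral_of_abs_sub_le hg hL (σ := fun w s => Real.sin (w * s))
    (fun w s => Real.abs_sin_le_one _) hsw hcw (fun w => hcont (c + w ^ 2) 0 0) hψ0 hsc
  have hβ0 := tendsto_integral_of_abs_sub_le hg hL (σ := fun w s => Real.cos (w * s))
    (fun w s => Real.abs_cos_le_one _) hcw hcw (fun w => hcont (c + w ^ 2) 0 0) hψ0 hcc
  have hα1 := tendsto_integral_of_abs_sub_le hg hL (σ := fun w s => Real.sin (w * s))
    (fun w s => Real.abs_sin_le_one _) hsw hsw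
    (fun w => (hcont (c + w ^ 2) 0 1).const_mul w) hψ1 hss
  have hβ1 := tendsto_integral_of_abs_sub_le hg hL (σ := fun w s => Real.cos (w * s))
    (fun w s => Real.abs_cos_le_one _) hcw hsw
    (fun w => (hcont (c + w ^ 2) 0 1).const_mul w) hψ1 hcs
  set ε := η * L / (9 * Real.pi) with hε
  have hε0 : 0 < ε := by positivity
  have small : ∀ {f : ℝ → ℝ}, Tendsto f atTop (𝓝 0) → ∀ᶠ w in atTop, |f w| ≤ ε := fun h => by
    filter_upwards [h (Metric.closedBall_mem_nhds 0 hε0)] with w hw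
    simpa [Real.dist_eq] using hw
  have hmain : ∀ᶠ w : ℝ in atTop, 4 ≤ (W (c + w ^ 2) L).trace ^ 2 →
      ∃ n : ℕ, |w ^ 2 - (Real.pi * n / L) ^ 2| ≤ η := by
    have hsq : ∀ᶠ w : ℝ in atTop, 3 * Real.pi * ε ≤ w ^ 2 * L :=
      ((tendsto_pow_atTop two_ne_zero).atTop_mul_const hL).eventually_ge_atTop _
    filter_upwards [small hα0, small hβ0, small hα1, small hβ1, hsq, eventually_gt_atTop 0]
      with w ha₀ hb₀ ha₁ hb₁ hεw hw htr
    have h0 := (hW (c + w ^ 2)).duhamel hp hw.ne' L 0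
    have h1 := (hW (c + w ^ 2)).duhamel hp hw.ne' L 1
    have e : ∀ f : ℝ → ℝ, (∫ s in (0:ℝ)..L, (p s - c) * (f s * (w * W (c + w ^ 2) s 0 1))) =
        w * ∫ s in (0:ℝ)..L, (p s - c) * (f s * W (c + w ^ 2) s 0 1) := fun f => by
      rw [← intervalIntegral.integral_const_mul]
      congr 1
      ext s
      ring
    have hdet := (hW (c + w ^ 2)).det_eq hp L
    have hdiv : ∀ {t : ℝ}, |t| ≤ ε → |t / w| ≤ ε / w := fun h => by
      rw [abs_div, abs_of_pos hw]
      exact div_le_div_of_nonneg_right h hw.le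
    rw [e fun s => Real.sin (w * s)] at ha₁
    rw [e fun s => Real.cos (w * s)] at hb₁
    rw [Matrix.trace_fin_two] at htr
    have hS := abs_le_of_four_le_sq_trace (m₀₀ := W (c + w ^ 2) L 0 0)
      (m₀₁ := w * W (c + w ^ 2) L 0 1) (m₁₀ := W (c + w ^ 2) L 1 0 / w)
      (m₁₁ := W (c + w ^ 2) L 1 1) (div_pos hε0 hw) (Real.sin_sq_add_cos_sq (w * L))
      (hdiv ha₀) (hdiv ha₁) (hdiv hb₀) (hdiv hb₁)
      (by rw [h0.1]; simp; ring) (by rw [h0.2]; simp; field_simp)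
      (by rw [h1.1]; simp; field_simp) (by rw [h1.2]; simp; field_simp)
      (by rw [← hdet]; field_simp) htr
    obtain ⟨n, hn⟩ := exists_int_abs_sq_sub_le hL hw (hS.trans (le_of_eq (by ring))) hεw
    refine ⟨n, hn.trans (le_of_eq ?_)⟩
    rw [hε]
    field_simp
  have hsqrt : Tendsto (fun E => Real.sqrt (E - c)) atTop atTop :=
    Real.tendsto_sqrt_atTop.comp (tendsto_atTop_add_const_right _ _ tendsto_id)
  filter_upwards [hsqrt.eventually hmain, eventually_ge_atTop c] with E hE hcE htr
  have e : Real.sqrt (E - c) ^ 2 = E - c := Real.sq_sqrt (sub_nonneg.2 hcE)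
  rw [e, add_sub_cancel] at hE
  exact hE htr

end Asymptotics

/-! ### Gaps without exactly one eigenvalue -/

section Gaps

variable {a : ℝ}

theorem mem_Fset_of_frequently {y : ℝ}
    (h : ∀ δ > 0, ∀ b : ℝ, ∃ m n : ℕ, b < n ∧ |y - n * (m - n * a)| < δ) : y ∈ Fset a := by
  intro δ hδ hfin
  obtain ⟨B, hB⟩ := (hfin.image Prod.snd).bddAbove
  obtain ⟨m, n, hn, hmn⟩ := h δ hδ (max 0 B)
  have hn' : max 0 B < (n : ℤ) := by exact_mod_cast hn
  have := hB ⟨((m : ℤ), (n : ℤ)), ⟨by have := le_max_left 0 B; simp only; omega, by simpa using hmn⟩,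
    rfl⟩
  simp only at this
  have := le_max_right 0 B
  omega

theorem abs_sub_mul_lt {D η δ m n : ℝ} (ha : 0 < a) (hm : 0 ≤ m) (hn : 0 < n) (hη : η ≤ 1)
    (hηδ : a * η < Real.pi ^ 2 * (δ / 2))
    (hδn : a ^ 2 * (|D| + 2) < Real.pi ^ 2 * (n * a) * min 1 (a * δ))
    (h : |D - ((Real.pi * m / a) ^ 2 - (Real.pi * n) ^ 2)| ≤ 2 * η) :
    |a * D / (2 * Real.pi ^ 2) - n * (m - n * a)| < δ := by
  have hpi : 0 < Real.pi ^ 2 := by have := Real.pi_pos; positivity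
  set t := m - n * a with ht
  have e1 : a ^ 2 * (D - ((Real.pi * m / a) ^ 2 - (Real.pi * n) ^ 2)) =
      a ^ 2 * D - Real.pi ^ 2 * (t * (m + n * a)) := by
    rw [ht]
    field_simp
    ring
  have h1 : |a ^ 2 * D - Real.pi ^ 2 * (t * (m + n * a))| ≤ a ^ 2 * (2 * η) := by
    rw [← e1, abs_mul, abs_of_pos (by positivity : 0 < a ^ 2)]
    exact mul_le_mul_of_nonneg_left h (by positivity)
  have h2 : Real.pi ^ 2 * (|t| * (n * a)) ≤ a ^ 2 * (|D| + 2) := by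
    have h3 : |Real.pi ^ 2 * (t * (m + n * a))| ≤ a ^ 2 * |D| + a ^ 2 * (2 * η) := by
      have := abs_sub_abs_le_abs_sub (Real.pi ^ 2 * (t * (m + n * a))) (a ^ 2 * D)
      rw [abs_sub_comm, abs_mul (a ^ 2), abs_of_pos (by positivity : 0 < a ^ 2)] at this
      linarith
    have hmn : 0 < m + n * a := by positivity
    rw [abs_mul, abs_mul, abs_of_pos hpi, abs_of_pos hmn] at h3
    have h4 : |t| * (n * a) ≤ |t| * (m + n * a) :=
      mul_le_mul_of_nonneg_left (by linarith) (abs_nonneg _)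
    have h5 : a ^ 2 * (2 * η) ≤ a ^ 2 * 2 := mul_le_mul_of_nonneg_left (by linarith) (by positivity)
    have h6 := mul_le_mul_of_nonneg_left h4 hpi.le
    linarith
  have ht1 : |t| < min 1 (a * δ) := by
    have hna : 0 < Real.pi ^ 2 * (n * a) := by positivity
    refine lt_of_mul_lt_mul_left ?_ hna.le
    linarith
  have ht2 : t ^ 2 < a * δ := by
    rw [← sq_abs]
    have h7 := ht1.trans_le (min_le_left _ _)
    have h8 := ht1.trans_le (min_le_right _ _)
    nlinarith [abs_nonneg t]
  have e2 : a * D / (2 * Real.pi ^ 2) - n * t =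
      (a ^ 2 * D - Real.pi ^ 2 * (t * (m + n * a))) / (2 * a * Real.pi ^ 2) + t ^ 2 / (2 * a) := by
    have hm' : m = t + n * a := by rw [ht]; ring
    rw [hm']
    have := hpi.ne'
    field_simp
    ring
  rw [e2]
  refine (abs_add_le _ _).trans_lt ?_
  have h9 : |(a ^ 2 * D - Real.pi ^ 2 * (t * (m + n * a))) / (2 * a * Real.pi ^ 2)| < δ / 2 := by
    rw [abs_div, abs_of_pos (by positivity : 0 < 2 * a * Real.pi ^ 2), div_lt_iff₀ (by positivity)]
    refine h1.trans_lt ?_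
    nlinarith
  have h10 : |t ^ 2 / (2 * a)| < δ / 2 := by
    rw [abs_of_nonneg (by positivity), div_lt_iff₀ (by positivity)]
    linarith
  linarith

variable {q_per q_def q : ℝ → ℝ} {U N : ℝ → ℝ → Matrix (Fin 2) (Fin 2) ℝ}

theorem IsGap.exists_four_le_sq_trace (ha : 0 < a) (hp : IsPotential q_per)
    (hd : IsPotential q_def) (hper : ∀ x, q_per (x + a) = q_per x)
    (hU : ∀ E, IsFundamentalSolution q_per E (U E)) (hN : ∀ E, IsFundamentalSolution q_def E (N E))
    (hq : ∀ x, q x = if x ≤ 0 then q_per x else if x < 1 then q_def x else q_per (x - 1))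
    {G : Set ℝ} (hG : IsGap (fun E => (U E a).trace) G)
    (hcard : {E ∈ G | IsDefectEigenvalue q E}.encard ≠ 1) :
    ∃ E ∈ closure G, 4 ≤ (U E a).trace ^ 2 ∧ 4 ≤ (N E 1).trace ^ 2 := by
  have hMc := isClockwise hp hU ha
  have hNc := isClockwise hd hN one_pos
  obtain ⟨x, y, σ, hxy, rfl, hσ, hk, hx, hy⟩ := hG.exists_eq_Ioo hMc.continuous_trace
  have hσ2 : σ ^ 2 = 1 := by rcases hσ with rfl | rfl <;> norm_num
  have hge : ∀ E ∈ Icc x y, 4 ≤ (U E a).trace ^ 2 := by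
    intro E hE
    have h2 : 2 ≤ σ * (U E a).trace := by
      rcases hE.1.eq_or_lt with rfl | h1
      · exact hx.ge
      rcases hE.2.eq_or_lt with rfl | h2
      · exact hy.ge
      exact (hk E ⟨h1, h2⟩).le
    have : (σ * (U E a).trace) ^ 2 = (U E a).trace ^ 2 := by rw [mul_pow, hσ2, one_mul]
    rw [← this]
    nlinarith
  rw [closure_Ioo hxy.ne]
  by_contra! hcon
  refine hcard ?_
  obtain ⟨E, ⟨hE, hEt⟩, huniq⟩ := existsUnique_crossing hMc hNc hxy hσ hk hx hy
    fun E hE => hcon E hE (hge E hE)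
  have hiff : ∀ E ∈ Ioo x y, (IsDefectEigenvalue q E ↔
      (U E a * N E 1).trace = contractingEigenvalue σ (U E a).trace * (N E 1).trace) := by
    intro E hE
    obtain ⟨l, h1, h2, h3, -⟩ := contractingEigenvalue_spec hσ (hk E hE)
    exact isDefectEigenvalue_iff ha hp hd hper hq (hU E) (hN E) h1 h2 h3
  rw [encard_eq_one]
  refine ⟨E, ?_⟩
  ext E'
  simp only [mem_ofPred_eq, mem_singleton_iff]
  constructor
  · rintro ⟨hE', h⟩
    exact huniq E' ⟨hE', (hiff E' hE').1 h⟩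
  · rintro rfl
    exact ⟨hE, (hiff _ hE).2 hEt⟩

theorem exists_le_of_infinite_gaps {M : ℝ → Matrix (Fin 2) (Fin 2) ℝ} (hM : IsClockwise M)
    {R : ℝ} (hR : ∀ E ≤ R, 4 < (M E).trace ^ 2) {P : Set ℝ → Prop}
    (hinf : {G | IsGap (fun E => (M E).trace) G ∧ P G}.Infinite) (b : ℝ) :
    ∃ G, IsGap (fun E => (M E).trace) G ∧ P G ∧ ∀ E ∈ closure G, b ≤ E := by
  obtain ⟨G, ⟨hG, hP⟩, hGn⟩ := (hinf.sdiff (hM.finite_gaps R b)).nonempty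
  refine ⟨G, hG, hP, fun E hE => ?_⟩
  refine closure_minimal (t := Ici b) (fun E' hE' => ?_) isClosed_Ici hE
  show b ≤ E'
  by_contra! hlt
  have hRE : R < E' := hG.subset_Ioi hR hE'
  exact hGn ⟨hG, E', hE', hRE.le, hlt.le⟩

theorem mem_Fset_of_infinite_gaps (ha : 0 < a) (hp : IsPotential q_per)
    (hd : IsPotential q_def) (hper : ∀ x, q_per (x + a) = q_per x)
    (hU : ∀ E, IsFundamentalSolution q_per E (U E)) (hN : ∀ E, IsFundamentalSolution q_def E (N E))
    (hq : ∀ x, q x = if x ≤ 0 then q_per x else if x < 1 then q_def x else q_per (x - 1))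
    (hinf : {G : Set ℝ | IsGap (fun E => (U E a).trace) G ∧
      {E ∈ G | IsDefectEigenvalue q E}.encard ≠ 1}.Infinite) :
    a * ((∫ y in (0:ℝ)..1, q_def y) - (1 / a) * ∫ y in (0:ℝ)..a, q_per y) / (2 * Real.pi ^ 2) ∈
      Fset a := by
  set cd := ∫ y in (0:ℝ)..1, q_def y with hcd
  set cp := (1 / a) * ∫ y in (0:ℝ)..a, q_per y with hcp
  obtain ⟨R, hR⟩ := exists_four_lt_sq_trace hp hU ha
  have hpi := Real.pi_pos
  refine mem_Fset_of_frequently fun δ hδ b => ?_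
  obtain ⟨η, hη0, hη⟩ : ∃ η, 0 < η ∧ η < min 1 (Real.pi ^ 2 * (δ / 2) / a) :=
    exists_between (by positivity)
  rw [lt_min_iff, lt_div_iff₀ ha] at hη
  set B := max 0 (max b (a ^ 2 * (|cd - cp| + 2) / (Real.pi ^ 2 * a * min 1 (a * δ)))) with hB
  obtain ⟨T, hT⟩ := eventually_atTop.1 ((eventually_exists_abs_sub_sq_le hp hU ha hcp hη0).and
    (eventually_exists_abs_sub_sq_le (c := cd) hd hN one_pos (by rw [hcd, div_one, one_mul]) hη0))
  obtain ⟨G, hG, hcard, hGb⟩ := exists_le_of_infinite_gaps (isClockwise hp hU ha) hR hinf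
    (max T (cd + 2 + (Real.pi * B) ^ 2))
  obtain ⟨E, hEG, hE1, hE2⟩ := hG.exists_four_le_sq_trace ha hp hd hper hU hN hq hcard
  have hEb := max_le_iff.1 (hGb E hEG)
  obtain ⟨h1, h2⟩ := hT E hEb.1
  obtain ⟨m, hm⟩ := h1 hE1
  obtain ⟨n, hn⟩ := h2 hE2
  rw [div_one] at hn
  have hBn : B < n := by
    have h3 : (Real.pi * B) ^ 2 < (Real.pi * n) ^ 2 := by
      linarith [(abs_le.1 hn).2]
    exact lt_of_mul_lt_mul_left (lt_of_pow_lt_pow_left₀ 2 (by positivity) h3) hpi.le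
  simp only [hB, max_lt_iff] at hBn
  obtain ⟨hn0, hbn, hn1⟩ := hBn
  refine ⟨m, n, hbn, abs_sub_mul_lt ha m.cast_nonneg hn0 hη.1.le (by linarith) ?_ ?_⟩
  · rw [div_lt_iff₀ (by positivity)] at hn1
    linarith
  · have e : cd - cp - ((Real.pi * m / a) ^ 2 - (Real.pi * n) ^ 2) =
        (E - cp - (Real.pi * m / a) ^ 2) - (E - cd - (Real.pi * n) ^ 2) := by ring
    rw [e]
    exact (abs_sub _ _).trans (by linarith)

end Gaps

/-- **Generalized Zheludev theorem.** With `q = q_per` on `(-∞, 0]`, `q = q_def` on `(0, 1)`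
and `q = q_per (· - 1)` on `[1, ∞)`, monodromy matrix `M E = U E a` and Floquet
discriminant `k E = trace (M E)`: if `a * Δq / (2π²) ∉ 𝓕(a)`, where
`Δq = ∫₀¹ q_def - (1/a) ∫₀ᵃ q_per`, then all but finitely many gaps contain exactly one
defect eigenvalue. -/
theorem all_but_finitely_many_gaps_have_exactly_one_eigenvalue
    (a : ℝ) (ha : 0 < a) (q_per q_def : ℝ → ℝ)
    (hperb : ∃ C, ∀ x, |q_per x| ≤ C) (hdefb : ∃ C, ∀ x, |q_def x| ≤ C)
    (hperc : PiecewiseContinuous q_per) (hdefc : PiecewiseContinuous q_def)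
    (hper : ∀ x, q_per (x + a) = q_per x)
    (U N : ℝ → ℝ → Matrix (Fin 2) (Fin 2) ℝ)
    (hU : ∀ E, IsFundamentalSolution q_per E (U E))
    (hN : ∀ E, IsFundamentalSolution q_def E (N E))
    (q : ℝ → ℝ)
    (hq : ∀ x, q x = if x ≤ 0 then q_per x else if x < 1 then q_def x else q_per (x - 1))
    (k : ℝ → ℝ) (hk : ∀ E, k E = (U E a).trace)
    (Δq : ℝ)
    (hΔq : Δq = (∫ y in (0:ℝ)..1, q_def y) - (1 / a) * ∫ y in (0:ℝ)..a, q_per y)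
    (hF : a * Δq / (2 * Real.pi ^ 2) ∉ Fset a) :
    {G : Set ℝ | IsGap k G ∧
      {E ∈ G | IsDefectEigenvalue q E}.encard ≠ 1}.Finite := by
  obtain rfl : k = fun E => (U E a).trace := funext hk
  by_contra hinf
  subst hΔq
  exact hF (mem_Fset_of_infinite_gaps ha (hperc.isPotential hperb) (hdefc.isPotential hdefb) hper
    hU hN hq hinf)
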